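/- There is a constant α > 0 such that for every finite ultrametric space U' = (U', d) there exist a subspace U ⊆ U' with diam(U) = diam(U') and a probability distribution D over MSS request sequences in U satisfying the following for every starting point s ∈ U: (i) for every deterministic online algorithm A, even when an escape price of 2·diam(U) is available throughout, E_{ρ∼D}[c_{A,s}(ρ)] ≥ diam(U) ≥ E_{ρ∼D}[c_{opt,s}(ρ)]; (ii) there exists h(U) ∈ ℕ such that for all h ≥ h(U), h·diam(U) ≥ α·log|U'|·E_{(ρ_1,…,ρ_h)∼D^h}[c_{opt,s}(ρ_1ρ_2⋯ρ_h)], where ρ_1⋯ρ_h is the concatenation of h i.i.d. samples from D. -/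

import Mathlib

open scoped Classical

/-- `d` is a metric on `M`. -/
def IsMetric {M : Type*} (d : M → M → ℝ) : Prop :=
  (∀ x y, d x y = 0 ↔ x = y) ∧ (∀ x y, d x y = d y x) ∧
    ∀ x y z, d x z ≤ d x y + d y z

/-- The point occupied by the online algorithm `A` (with starting point `s`)
after serving the first `t` requests of `σ`. -/
def mssPoint {M : Type*} (A : List (Finset M) → M) (s : M)
    (σ : List (Finset M)) (t : ℕ) : M :=
  if t = 0 then s else A (σ.take t)

/-- The cost of the deterministic online algorithm `A` on the MSS request
sequence `σ`, starting at `s`. -/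
def mssCost {M : Type*} (d : M → M → ℝ) (A : List (Finset M) → M) (s : M)
    (σ : List (Finset M)) : ℝ :=
  ∑ t ∈ Finset.range σ.length, d (mssPoint A s σ t) (mssPoint A s σ (t + 1))

/-- `A` is a valid deterministic online algorithm for MSS: after each (nonempty)
prefix, it occupies a point of the last request. -/
def MssAlg {M : Type*} (A : List (Finset M) → M) : Prop :=
  ∀ (l : List (Finset M)) (r : Finset M), r.Nonempty → A (l ++ [r]) ∈ r

/-- `x` is a feasible (offline) point sequence serving `σ` from `s`. -/
def MssServes {M : Type*} (s : M) (σ : List (Finset M)) (x : ℕ → M) : Prop :=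
  x 0 = s ∧ ∀ (t : ℕ) (h : t < σ.length), x (t + 1) ∈ σ.get ⟨t, h⟩

/-- Optimal (offline) cost of serving `σ` from `s`. -/
noncomputable def mssOpt {M : Type*} (d : M → M → ℝ) (s : M)
    (σ : List (Finset M)) : ℝ :=
  sInf {c | ∃ x : ℕ → M, MssServes s σ x ∧
    c = ∑ t ∈ Finset.range σ.length, d (x t) (x (t + 1))}

/-- `C` is a distributional lower bound for MSS on `(M,d)` with starting point `s`
and request sets of size at most `w`. -/
def MssDLB {M : Type*} (d : M → M → ℝ) (s : M) (w : ℕ) (C : ℝ) : Prop :=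
  ∀ B : ℝ, 0 ≤ B → ∃ (N : ℕ) (P : Fin N → ℝ) (ρ : Fin N → List (Finset M)),
    (∀ ω, 0 ≤ P ω) ∧ (∑ ω, P ω) = 1 ∧
    (∀ ω, ∀ r ∈ ρ ω, r.Nonempty ∧ r.card ≤ w) ∧
    B ≤ (∑ ω, P ω * mssOpt d s (ρ ω)) ∧
    ∀ A : List (Finset M) → M, MssAlg A →
      C * (∑ ω, P ω * mssOpt d s (ρ ω)) ≤ ∑ ω, P ω * mssCost d A s (ρ ω)

/-- Auxiliary recursion for the cost of an online algorithm `A` with escape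
option `esc` and escape price `p`: `pre` is the prefix of requests already
served, `x` the current point, and the third argument the remaining requests.
If `esc` fires on a prefix, the algorithm bails out, paying `p` and nothing
afterwards (including for the request on which it bails out). -/
def mssEscCostAux {M : Type*} (d : M → M → ℝ) (p : ℝ) (A : List (Finset M) → M)
    (esc : List (Finset M) → Bool) :
    List (Finset M) → M → List (Finset M) → ℝ
  | _, _, [] => 0
  | pre, x, r :: rest =>
    if esc (pre ++ [r]) then p
    else d x (A (pre ++ [r])) +
      mssEscCostAux d p A esc (pre ++ [r]) (A (pre ++ [r])) rest

/-- Cost of `A` on `σ` from `s` when the escape price `p` is available at the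
requests where `esc` may fire. Taking `esc ≡ false` recovers `mssCost`. -/
def mssEscCost {M : Type*} (d : M → M → ℝ) (p : ℝ) (A : List (Finset M) → M)
    (esc : List (Finset M) → Bool) (s : M) (σ : List (Finset M)) : ℝ :=
  mssEscCostAux d p A esc [] s σ

/-- Concatenation of the first `i` chunks of the chunk sequence `ρ ω`. -/
def chunkPrefix {N m : ℕ} {R : Type*} (ρ : Fin N → Fin m → List R) (ω : Fin N)
    (i : ℕ) : List R :=
  ((List.ofFn (ρ ω)).take i).flatten

universe u

/-- `E` is the expectation functional of a finitely supported probability distribution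
concentrated on `G`. -/
def IsExpectation {α : Type*} (G : Set α) (E : (α → ℝ) → ℝ) : Prop :=
  ∃ (ι : Type) (_ : Fintype ι) (P : ι → ℝ) (ρ : ι → α),
    (∀ i, 0 ≤ P i) ∧ ∑ i, P i = 1 ∧ (∀ i, ρ i ∈ G) ∧ ∀ φ, E φ = ∑ i, P i * φ (ρ i)

namespace IsExpectation

variable {α β : Type*} {G : Set α} {G' : Set β} {E : (α → ℝ) → ℝ} {E' : (β → ℝ) → ℝ}

lemma add (h : IsExpectation G E) (φ ψ : α → ℝ) :
    E (fun a => φ a + ψ a) = E φ + E ψ := by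
  obtain ⟨ι, _, P, ρ, -, -, -, hE⟩ := h
  simp [hE, mul_add, Finset.sum_add_distrib]

lemma const_mul (h : IsExpectation G E) (c : ℝ) (φ : α → ℝ) :
    E (fun a => c * φ a) = c * E φ := by
  obtain ⟨ι, _, P, ρ, -, -, -, hE⟩ := h
  simp only [hE, Finset.mul_sum]
  exact Finset.sum_congr rfl fun i _ => by ring

lemma const (h : IsExpectation G E) (c : ℝ) : E (fun _ => c) = c := by
  obtain ⟨ι, _, P, ρ, -, h1, -, hE⟩ := h
  rw [hE, ← Finset.sum_mul, h1, one_mul]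

lemma mono (h : IsExpectation G E) {φ ψ : α → ℝ} (hφ : ∀ a ∈ G, φ a ≤ ψ a) :
    E φ ≤ E ψ := by
  obtain ⟨ι, _, P, ρ, h0, -, hG, hE⟩ := h
  simp only [hE]
  exact Finset.sum_le_sum fun i _ => mul_le_mul_of_nonneg_left (hφ _ (hG i)) (h0 i)

lemma congr (h : IsExpectation G E) {φ ψ : α → ℝ} (hφ : ∀ a ∈ G, φ a = ψ a) :
    E φ = E ψ :=
  le_antisymm (h.mono fun a ha => (hφ a ha).le) (h.mono fun a ha => (hφ a ha).ge)

lemma const_add (h : IsExpectation G E) (c : ℝ) (φ : α → ℝ) :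
    E (fun a => c + φ a) = c + E φ := by
  rw [h.add, h.const]

lemma nonneg (h : IsExpectation G E) {φ : α → ℝ} (hφ : ∀ a ∈ G, 0 ≤ φ a) : 0 ≤ E φ := by
  rw [← h.const 0]
  exact h.mono hφ

lemma swap (h : IsExpectation G E) (h' : IsExpectation G' E') (φ : α → β → ℝ) :
    E (fun a => E' (fun b => φ a b)) = E' (fun b => E (fun a => φ a b)) := by
  obtain ⟨ι, _, P, ρ, -, -, -, hE⟩ := h
  obtain ⟨ι', _, P', ρ', -, -, -, hE'⟩ := h'
  simp only [hE, hE', Finset.mul_sum]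
  rw [Finset.sum_comm]
  exact Finset.sum_congr rfl fun i _ => Finset.sum_congr rfl fun j _ => by ring

lemma dirac {a : α} (ha : a ∈ G) : IsExpectation G (fun φ => φ a) :=
  ⟨Unit, inferInstance, fun _ => 1, fun _ => a, by simp, by simp, by simpa, by simp⟩

lemma map (h : IsExpectation G E) {f : α → β} (hf : ∀ a ∈ G, f a ∈ G') :
    IsExpectation G' (fun φ => E (fun a => φ (f a))) := by
  obtain ⟨ι, _, P, ρ, h0, h1, hG, hE⟩ := h
  exact ⟨ι, inferInstance, P, fun i => f (ρ i), h0, h1, fun i => hf _ (hG i), fun φ => hE _⟩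

lemma mono_set (h : IsExpectation G E) {H : Set α} (hf : G ⊆ H) : IsExpectation H E :=
  h.map (f := fun a => a) hf

lemma prod (h : IsExpectation G E) (h' : IsExpectation G' E') :
    IsExpectation (G ×ˢ G') (fun φ => E (fun a => E' (fun b => φ (a, b)))) := by
  obtain ⟨ι, _, P, ρ, h0, h1, hG, hE⟩ := h
  obtain ⟨ι', _, P', ρ', h0', h1', hG', hE'⟩ := h'
  refine ⟨ι × ι', inferInstance, fun x => P x.1 * P' x.2, fun x => (ρ x.1, ρ' x.2),
    fun x => mul_nonneg (h0 _) (h0' _), ?_, fun x => ⟨hG _, hG' _⟩, fun φ => ?_⟩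
  · rw [Fintype.sum_prod_type, ← Finset.sum_mul_sum, h1, h1', one_mul]
  · simp only [hE, hE', Fintype.sum_prod_type, Finset.mul_sum, mul_assoc]

lemma mix {E₁ E₂ : (α → ℝ) → ℝ} (h₁ : IsExpectation G E₁) (h₂ : IsExpectation G E₂) {θ : ℝ}
    (h0 : 0 ≤ θ) (h1 : θ ≤ 1) : IsExpectation G (fun φ => (1 - θ) * E₁ φ + θ * E₂ φ) := by
  obtain ⟨ι, _, P, ρ, hP, h1P, hG, hE⟩ := h₁
  obtain ⟨ι', _, P', ρ', hP', h1P', hG', hE'⟩ := h₂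
  refine ⟨ι ⊕ ι', inferInstance, Sum.elim (fun i => (1 - θ) * P i) (fun i => θ * P' i),
    Sum.elim ρ ρ', ?_, ?_, ?_, fun φ => ?_⟩
  · rintro (i | i)
    · exact mul_nonneg (by linarith) (hP i)
    · exact mul_nonneg h0 (hP' i)
  · simp [← Finset.mul_sum, h1P, h1P']
  · rintro (i | i)
    · exact hG i
    · exact hG' i
  · simp [hE, hE', Finset.mul_sum, mul_assoc]

end IsExpectation

/-- Expectation over words of `n` independent letters. -/
def iterExp {α : Type*} (E : (α → ℝ) → ℝ) : ℕ → (List α → ℝ) → ℝ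
  | 0, φ => φ []
  | n + 1, φ => E (fun a => iterExp E n (fun w => φ (a :: w)))

section iterExp

variable {α β : Type*} {G : Set α} {E : (α → ℝ) → ℝ}

lemma isExpectation_iterExp (h : IsExpectation G E) (n : ℕ) :
    IsExpectation {w : List α | w.length = n ∧ ∀ a ∈ w, a ∈ G} (iterExp E n) := by
  induction n with
  | zero => exact IsExpectation.dirac (by simp)
  | succ n ih =>
    refine (h.prod ih).map (f := fun x : α × List α => x.1 :: x.2) ?_
    rintro ⟨a, w⟩ ⟨ha, hw, hw'⟩
    exact ⟨by simp_all, by simpa using ⟨ha, hw'⟩⟩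

lemma iterExp_add (m n : ℕ) (φ : List α → ℝ) :
    iterExp E (m + n) φ = iterExp E m (fun u => iterExp E n (fun w => φ (u ++ w))) := by
  induction m generalizing φ with
  | zero => simp [iterExp]
  | succ m ih =>
    rw [Nat.succ_add]
    simp [iterExp, ih]

lemma iterExp_succ_last (m : ℕ) (φ : List α → ℝ) :
    iterExp E (m + 1) φ = iterExp E m (fun u => E (fun a => φ (u ++ [a]))) := by
  rw [iterExp_add]
  rfl

lemma iterExp_mul (q n : ℕ) (φ : List α → ℝ) :
    iterExp E (q * n) φ = iterExp (iterExp E n) q (fun ws => φ ws.flatten) := by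
  induction q generalizing φ with
  | zero => simp [iterExp]
  | succ q ih =>
    rw [Nat.succ_mul, Nat.add_comm, iterExp_add]
    simp [iterExp, ih]

lemma iterExp_map (f : α → β) (n : ℕ) (φ : List β → ℝ) :
    iterExp (fun ψ => E (fun a => ψ (f a))) n φ = iterExp E n (fun w => φ (w.map f)) := by
  induction n generalizing φ with
  | zero => simp [iterExp]
  | succ n ih => simp [iterExp, ih]

end iterExp

lemma IsMetric.nonneg {M : Type*} {d : M → M → ℝ} (hd : IsMetric d) (x y : M) : 0 ≤ d x y := by
  have h1 := hd.2.2 x y x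
  have h2 := hd.2.1 x y
  have h3 := (hd.1 x x).2 rfl
  linarith

/-- Sequences of nonempty requests inside `U`. -/
def requestSeqs {M : Type*} (U : Finset M) : Set (List (Finset M)) :=
  {σ | ∀ r ∈ σ, r.Nonempty ∧ r ⊆ U}

section offline

variable {M : Type*}

/-- Offline cost from `s`, by dynamic programming. -/
noncomputable def dpOpt (d : M → M → ℝ) : M → List (Finset M) → ℝ
  | _, [] => 0
  | s, r :: σ => ⨅ y : r, (d s y + dpOpt d y σ)

/-- Offline cost with a free choice of the starting point in `U`. -/
noncomputable def freeOpt (d : M → M → ℝ) (U : Finset M) (σ : List (Finset M)) : ℝ :=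
  ⨅ s : U, dpOpt d s σ

variable {d : M → M → ℝ} {U : Finset M}

lemma dpOpt_cons_le {s y : M} {r : Finset M} (hy : y ∈ r) (σ : List (Finset M)) :
    dpOpt d s (r :: σ) ≤ d s y + dpOpt d y σ :=
  ciInf_le (f := fun y : r => d s y + dpOpt d y σ) (Set.finite_range _).bddBelow ⟨y, hy⟩

lemma exists_dpOpt_cons {s : M} {r : Finset M} (hr : r.Nonempty) (σ : List (Finset M)) :
    ∃ y ∈ r, dpOpt d s (r :: σ) = d s y + dpOpt d y σ := by
  have : Nonempty r := hr.to_subtype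
  obtain ⟨y, hy⟩ := exists_eq_ciInf_of_finite (f := fun y : r => d s y + dpOpt d y σ)
  exact ⟨y, y.2, hy.symm⟩

lemma freeOpt_le {s : M} (hs : s ∈ U) (σ : List (Finset M)) : freeOpt d U σ ≤ dpOpt d s σ :=
  ciInf_le (f := fun s : U => dpOpt d s σ) (Set.finite_range _).bddBelow ⟨s, hs⟩

lemma exists_freeOpt (hU : U.Nonempty) (σ : List (Finset M)) :
    ∃ s ∈ U, freeOpt d U σ = dpOpt d s σ := by
  have : Nonempty U := hU.to_subtype
  obtain ⟨y, hy⟩ := exists_eq_ciInf_of_finite (f := fun s : U => dpOpt d s σ)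
  exact ⟨y, y.2, hy.symm⟩

lemma dpOpt_nonneg (hd : IsMetric d) (s : M) (σ : List (Finset M)) : 0 ≤ dpOpt d s σ := by
  induction σ generalizing s with
  | nil => exact le_rfl
  | cons r σ ih => exact Real.iInf_nonneg fun y => add_nonneg (hd.nonneg _ _) (ih _)

lemma dpOpt_le_add (hd : IsMetric d) (s t : M) {σ : List (Finset M)}
    (hσ : ∀ r ∈ σ, r.Nonempty) : dpOpt d s σ ≤ d s t + dpOpt d t σ := by
  cases σ with
  | nil => simpa [dpOpt] using hd.nonneg s t
  | cons r σ =>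
    obtain ⟨y, hy, h⟩ := exists_dpOpt_cons (d := d) (s := t) (hσ r (by simp)) σ
    have := dpOpt_cons_le (d := d) (s := s) hy σ
    have := hd.2.2 s t y
    linarith

/-- Some optimal way of serving `σ` ends at a point `e`, and any continuation can be
served from there. -/
lemma exists_dpOpt_append_le {s : M} (hs : s ∈ U) {σ : List (Finset M)} (hσ : σ ∈ requestSeqs U) :
    ∃ e ∈ U, ∀ τ, dpOpt d s (σ ++ τ) ≤ dpOpt d s σ + dpOpt d e τ := by
  induction σ generalizing s with
  | nil => exact ⟨s, hs, fun τ => by simp [dpOpt]⟩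
  | cons r σ ih =>
    obtain ⟨y, hy, h⟩ := exists_dpOpt_cons (d := d) (s := s) (hσ r (by simp)).1 σ
    obtain ⟨e, he, h'⟩ := ih ((hσ r (by simp)).2 hy) fun q hq => hσ q (by simp [hq])
    refine ⟨e, he, fun τ => ?_⟩
    have := dpOpt_cons_le (d := d) (s := s) hy (σ ++ τ)
    have := h' τ
    rw [List.cons_append]
    linarith

/-- An optimal path for `σ ++ τ` passes through a point `m` between the two parts. -/
lemma exists_dpOpt_append_split {s : M} (hs : s ∈ U) {σ : List (Finset M)}
    (hσ : σ ∈ requestSeqs U) (τ : List (Finset M)) :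
    ∃ m ∈ U, ∃ c, (∀ τ', dpOpt d s (σ ++ τ') ≤ c + dpOpt d m τ') ∧ dpOpt d s σ ≤ c ∧
      dpOpt d s (σ ++ τ) = c + dpOpt d m τ := by
  induction σ generalizing s with
  | nil => exact ⟨s, hs, 0, by simp, by simp [dpOpt], by simp⟩
  | cons r σ ih =>
    obtain ⟨y, hy, h⟩ := exists_dpOpt_cons (d := d) (s := s) (hσ r (by simp)).1 (σ ++ τ)
    obtain ⟨m, hm, c, h1, h2, h3⟩ :=
      ih ((hσ r (by simp)).2 hy) fun q hq => hσ q (by simp [hq])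
    refine ⟨m, hm, d s y + c, fun τ' => ?_, ?_, ?_⟩
    · have := dpOpt_cons_le (d := d) (s := s) hy (σ ++ τ')
      have := h1 τ'
      rw [List.cons_append]
      linarith
    · have := dpOpt_cons_le (d := d) (s := s) hy σ
      linarith
    · rw [List.cons_append, h, h3, add_assoc]

lemma freeOpt_append_ge (hU : U.Nonempty) {σ : List (Finset M)} (hσ : σ ∈ requestSeqs U)
    (τ : List (Finset M)) : freeOpt d U σ + freeOpt d U τ ≤ freeOpt d U (σ ++ τ) := by
  obtain ⟨s, hs, h⟩ := exists_freeOpt (d := d) hU (σ ++ τ)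
  obtain ⟨m, hm, c, -, h2, h3⟩ := exists_dpOpt_append_split (d := d) hs hσ τ
  have := freeOpt_le (d := d) hs σ
  have := freeOpt_le (d := d) hm τ
  linarith

/-- A detour serving `τ` costs two moves on top of the free cost of `τ`. -/
lemma freeOpt_detour_le (hd : IsMetric d) (hU : U.Nonempty) {Δ : ℝ}
    (hΔ : ∀ x ∈ U, ∀ y ∈ U, d x y ≤ Δ) {σ τ υ : List (Finset M)} (hσ : σ ∈ requestSeqs U)
    (hτ : τ ∈ requestSeqs U) (hυ : υ ∈ requestSeqs U) :
    freeOpt d U (σ ++ (τ ++ υ)) ≤ freeOpt d U (σ ++ υ) + 2 * Δ + freeOpt d U τ := by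
  obtain ⟨s, hs, h⟩ := exists_freeOpt (d := d) hU (σ ++ υ)
  obtain ⟨m, hm, c, h1, -, h3⟩ := exists_dpOpt_append_split (d := d) hs hσ υ
  obtain ⟨t, ht, h4⟩ := exists_freeOpt (d := d) hU τ
  obtain ⟨e, he, h5⟩ := exists_dpOpt_append_le (d := d) ht hτ
  have h6 := freeOpt_le (d := d) hs (σ ++ (τ ++ υ))
  have h7 := h1 (τ ++ υ)
  have h8 := dpOpt_le_add hd m t (σ := τ ++ υ) (by
    intro r hr
    rcases List.mem_append.1 hr with hr | hr
    exacts [(hτ r hr).1, (hυ r hr).1])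
  have h9 := h5 υ
  have h10 := dpOpt_le_add hd e m (σ := υ) fun r hr => (hυ r hr).1
  have := hΔ _ hm _ ht
  have := hΔ _ he _ hm
  linarith

lemma freeOpt_nonneg (hd : IsMetric d) (σ : List (Finset M)) : 0 ≤ freeOpt d U σ :=
  Real.iInf_nonneg fun _ => dpOpt_nonneg hd _ _

lemma dpOpt_le_diam_add_freeOpt (hd : IsMetric d) (hU : U.Nonempty) {Δ : ℝ}
    (hΔ : ∀ x ∈ U, ∀ y ∈ U, d x y ≤ Δ) {s : M} (hs : s ∈ U) {σ : List (Finset M)}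
    (hσ : σ ∈ requestSeqs U) : dpOpt d s σ ≤ Δ + freeOpt d U σ := by
  obtain ⟨t, ht, h⟩ := exists_freeOpt (d := d) hU σ
  have := dpOpt_le_add hd s t fun r hr => (hσ r hr).1
  have := hΔ _ hs _ ht
  linarith

lemma dpOpt_le_mul_length {Δ : ℝ}
    (hΔ : ∀ x ∈ U, ∀ y ∈ U, d x y ≤ Δ) {s : M} (hs : s ∈ U) {σ : List (Finset M)}
    (hσ : σ ∈ requestSeqs U) : dpOpt d s σ ≤ σ.length * Δ := by
  induction σ generalizing s with
  | nil => simp [dpOpt]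
  | cons r σ ih =>
    obtain ⟨y, hy⟩ := (hσ r (by simp)).1
    have hyU := (hσ r (by simp)).2 hy
    have := dpOpt_cons_le (d := d) (s := s) hy σ
    have := ih hyU fun q hq => hσ q (by simp [hq])
    have := hΔ _ hs _ hyU
    push_cast [List.length_cons]
    linarith

lemma exists_mssServes {s : M} {σ : List (Finset M)} (hσ : ∀ r ∈ σ, r.Nonempty) :
    ∃ x : ℕ → M, MssServes s σ x ∧
      dpOpt d s σ = ∑ t ∈ Finset.range σ.length, d (x t) (x (t + 1)) := by
  induction σ generalizing s with
  | nil => exact ⟨fun _ => s, ⟨rfl, by simp⟩, by simp [dpOpt]⟩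
  | cons r σ ih =>
    obtain ⟨y, hy, h⟩ := exists_dpOpt_cons (d := d) (s := s) (hσ r (by simp)) σ
    obtain ⟨x, ⟨hx0, hx⟩, hc⟩ := ih (s := y) fun q hq => hσ q (by simp [hq])
    refine ⟨fun n => Nat.casesOn n s x, ⟨rfl, fun t ht => ?_⟩, ?_⟩
    · cases t with
      | zero => simpa [hx0] using hy
      | succ t => simpa using hx t (by simpa using ht)
    · rw [h, hc, List.length_cons, Finset.sum_range_succ']
      rw [add_comm, ← hx0]
      rfl

lemma mssOpt_le_dpOpt (hd : IsMetric d) {s : M} {σ : List (Finset M)}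
    (hσ : ∀ r ∈ σ, r.Nonempty) : mssOpt d s σ ≤ dpOpt d s σ := by
  obtain ⟨x, hx, hc⟩ := exists_mssServes (d := d) hσ (s := s)
  refine csInf_le ⟨0, ?_⟩ ⟨x, hx, hc⟩
  rintro c ⟨y, -, rfl⟩
  exact Finset.sum_nonneg fun _ _ => hd.nonneg _ _

end offline

section online

variable {M : Type*} {d : M → M → ℝ} {U V : Finset M} {E E' : (List (Finset M) → ℝ) → ℝ}
  {p q v w f : ℝ} {s : M}

/-- Against the random request sequence `E`, every online algorithm with escape price `p`
starting at `s` (after an arbitrary history) pays at least `v`. -/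
def Game (d : M → M → ℝ) (E : (List (Finset M) → ℝ) → ℝ) (p v : ℝ) (s : M) : Prop :=
  ∀ A : List (Finset M) → M, MssAlg A → ∀ (esc : List (Finset M) → Bool) (pre : List (Finset M)),
    v ≤ E (fun σ => mssEscCostAux d p A esc pre s σ)

lemma mssEscCostAux_nonneg (hd : IsMetric d) (hp : 0 ≤ p) (A : List (Finset M) → M)
    (esc : List (Finset M) → Bool) (pre : List (Finset M)) (s : M) (σ : List (Finset M)) :
    0 ≤ mssEscCostAux d p A esc pre s σ := by
  induction σ generalizing pre s with
  | nil => exact le_rfl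
  | cons r σ ih =>
    rw [mssEscCostAux]
    split_ifs
    · exact hp
    · exact add_nonneg (hd.nonneg _ _) (ih _ _)

lemma mssEscCostAux_mono (hpq : p ≤ q) (A : List (Finset M) → M)
    (esc : List (Finset M) → Bool) (pre : List (Finset M)) (s : M) (σ : List (Finset M)) :
    mssEscCostAux d p A esc pre s σ ≤ mssEscCostAux d q A esc pre s σ := by
  induction σ generalizing pre s with
  | nil => exact le_rfl
  | cons r σ ih =>
    rw [mssEscCostAux, mssEscCostAux]
    split_ifs
    · exact hpq
    · exact add_le_add le_rfl (ih _ _)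

lemma Game.mono_price {G : Set (List (Finset M))} (hE : IsExpectation G E) (h : Game d E p v s)
    (hpq : p ≤ q) : Game d E q v s := fun A hA esc pre =>
  (h A hA esc pre).trans (hE.mono fun σ _ => mssEscCostAux_mono hpq A esc pre s σ)

/-- Playing one game after another adds the values, provided the first one is played with the
escape price reduced by the value of the second one. -/
lemma Game.append (hE : IsExpectation (requestSeqs U) E) {G : Set (List (Finset M))}
    (hE' : IsExpectation G E') (hs : s ∈ U) (h : Game d E (p - w) v s)
    (h' : ∀ x ∈ U, Game d E' p w x) :
    Game d (fun φ => E (fun a => E' (fun b => φ (a ++ b)))) p (v + w) s := by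
  intro A hA esc pre
  have key : ∀ a ∈ requestSeqs U, ∀ pre : List (Finset M), ∀ s ∈ U,
      w + mssEscCostAux d (p - w) A esc pre s a ≤
        E' (fun b => mssEscCostAux d p A esc pre s (a ++ b)) := by
    intro a
    induction a with
    | nil => intro _ pre s hs; simpa [mssEscCostAux] using h' s hs A hA esc pre
    | cons r a ih =>
      intro ha pre s hs
      have hr := ha r (by simp)
      simp only [List.cons_append, mssEscCostAux]
      split_ifs
      · rw [hE'.const]; linarith
      · rw [hE'.const_add]
        have := ih (fun q hq => ha q (by simp [hq])) (pre ++ [r]) _ (hr.2 (hA pre r hr.1))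
        linarith
  have h1 := hE.mono fun a ha => key a ha pre s hs
  rw [hE.const_add] at h1
  have := h A hA esc pre
  linarith

/-- If `V` is far away from `U`, adding `V` to all requests of a game in `U` does not help the
online algorithm. -/
lemma Game.union (hd : IsMetric d) (hp : 0 ≤ p) (hE : IsExpectation (requestSeqs U) E)
    (hUV : ∀ x ∈ U, ∀ y ∈ V, p ≤ d x y) (hs : s ∈ U) (h : Game d E p v s) :
    Game d (fun φ => E (fun σ => φ (σ.map (· ∪ V)))) p v s := by
  intro A hA esc pre
  let L : List (Finset M) → List (Finset M) := fun l => pre ++ l.map (· ∪ V)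
  let Q : List (Finset M) → Prop := fun l => ∃ τ r, l = τ ++ [r] ∧ A (L l) ∈ r
  let A' : List (Finset M) → M := fun l =>
    if Q l then A (L l) else
      if h : ∃ y, ∃ τ r, l = τ ++ [r] ∧ y ∈ r then h.choose else A []
  let esc' : List (Finset M) → Bool := fun l => esc (L l) || decide (¬ Q l)
  have hA' : MssAlg A' := by
    intro l r hr
    by_cases hQ : Q (l ++ [r])
    · obtain ⟨τ, r', h1, h2⟩ := hQ
      have : A' (l ++ [r]) = A (L (l ++ [r])) := if_pos ⟨τ, r', h1, h2⟩
      rw [this]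
      have : r = r' := by
        have := (List.append_inj' h1 rfl).2
        simpa using this
      exact Finset.mem_of_subset this.ge h2
    · have h1 : ∃ y, ∃ τ r', l ++ [r] = τ ++ [r'] ∧ y ∈ r' := ⟨hr.choose, l, r, rfl, hr.choose_spec⟩
      have : A' (l ++ [r]) = h1.choose := by
        simp only [A', if_neg hQ, dif_pos h1]
      rw [this]
      obtain ⟨τ, r', h2, h3⟩ := h1.choose_spec
      have : r = r' := by
        have := (List.append_inj' h2 rfl).2
        simpa using this
      exact Finset.mem_of_subset this.ge h3
  have key : ∀ σ ∈ requestSeqs U, ∀ τ : List (Finset M), ∀ x ∈ U,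
      mssEscCostAux d p A' esc' τ x σ ≤ mssEscCostAux d p A esc (L τ) x (σ.map (· ∪ V)) := by
    intro σ
    induction σ with
    | nil => intro _ τ x _; exact le_rfl
    | cons r σ ih =>
      intro hσ τ x hx
      have hr := hσ r (by simp)
      have hL : L τ ++ [r ∪ V] = L (τ ++ [r]) := by simp [L]
      simp only [List.map_cons, mssEscCostAux, hL]
      have hmem : A (L (τ ++ [r])) ∈ r ∪ V := by
        rw [← hL]
        exact hA _ _ (hr.1.mono Finset.subset_union_left)
      by_cases he : esc (L (τ ++ [r]))
      · simp [esc', he]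
      · by_cases hQ : Q (τ ++ [r])
        · have h1 : A' (τ ++ [r]) = A (L (τ ++ [r])) := if_pos hQ
          have h2 : A' (τ ++ [r]) ∈ r := hA' _ _ hr.1
          have := ih (fun q hq => hσ q (by simp [hq])) (τ ++ [r]) _ (hr.2 h2)
          simp only [esc', he, hQ, h1] at this ⊢
          simpa using this
        · have h1 : A (L (τ ++ [r])) ∈ V := by
            rcases Finset.mem_union.1 hmem with h | h
            · exact (hQ ⟨τ, r, rfl, h⟩).elim
            · exact h
          have := hUV x hx _ h1
          have := mssEscCostAux_nonneg hd hp A esc (L (τ ++ [r])) (A (L (τ ++ [r])))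
            (σ.map (· ∪ V))
          simp only [esc', he, hQ]
          simp
          linarith
  refine (h A' hA' esc' []).trans (hE.mono fun σ hσ => ?_)
  simpa [L] using key σ hσ [] s hs

/-- `E` is a random request sequence in `U` of value `v` at escape price `p`, of which `n`
independent copies can be served offline at cost `n * v / f`. -/
structure Play (d : M → M → ℝ) (E : (List (Finset M) → ℝ) → ℝ) (U : Finset M)
    (p v f : ℝ) : Prop where
  isExpectation : IsExpectation (requestSeqs U) E
  v_pos : 0 < v
  v_le : v ≤ p
  f_pos : 0 < f
  game : ∀ s ∈ U, Game d E p v s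
  offline : ∀ n, iterExp E n (fun w => freeOpt d U w.flatten) ≤ n * (v / f)

lemma Play.mono (h : Play d E U p v f) (hq : p ≤ q) {g : ℝ} (hg : 0 < g) (hgf : g ≤ f) :
    Play d E U q v g where
  isExpectation := h.isExpectation
  v_pos := h.v_pos
  v_le := h.v_le.trans hq
  f_pos := hg
  game s hs := (h.game s hs).mono_price h.isExpectation hq
  offline n := (h.offline n).trans <| by
    have := h.v_pos
    gcongr

lemma flatten_mem_requestSeqs {ws : List (List (Finset M))} (h : ∀ σ ∈ ws, σ ∈ requestSeqs U) :
    ws.flatten ∈ requestSeqs U := by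
  intro r hr
  obtain ⟨σ, hσ, hr⟩ := List.mem_flatten.1 hr
  exact h σ hσ r hr

lemma IsExpectation.flatten (h : IsExpectation (requestSeqs U) E) (k : ℕ) :
    IsExpectation (requestSeqs U) (fun φ => iterExp E k (fun w => φ w.flatten)) :=
  (isExpectation_iterExp h k).map fun _ hw => flatten_mem_requestSeqs hw.2

/-- Repeating a play. -/
lemma Play.repeat (h : Play d E U p v f) (k : ℕ) :
    Play d (fun φ => iterExp E (k + 1) (fun w => φ w.flatten)) U (p + k * v) ((k + 1) * v) f where
  isExpectation := h.isExpectation.flatten _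
  v_pos := by have := h.v_pos; positivity
  v_le := by have := h.v_le; linarith
  f_pos := h.f_pos
  game := by
    induction k with
    | zero => simpa [iterExp] using h.game
    | succ k ih =>
      intro s hs
      have := Game.append (p := p + (k + 1 : ℕ) * v) (w := (k + 1) * v)
        h.isExpectation (h.isExpectation.flatten (k + 1)) hs (d := d) (v := v)
        (by have := h.game s hs; push_cast; simpa using this)
        (fun x hx => (ih x hx).mono_price (h.isExpectation.flatten (k + 1))
          (by have := h.v_pos; push_cast; linarith))
      convert this using 1
      · simp [iterExp]
      · push_cast
        ring
  offline n := by
    have h1 := iterExp_map (E := iterExp E (k + 1)) List.flatten n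
      (fun w => freeOpt d U w.flatten)
    have h2 := iterExp_mul (E := E) n (k + 1) (fun w => freeOpt d U w.flatten)
    have h3 := h.offline (n * (k + 1))
    rw [h1]
    simp only [List.flatten_flatten] at h2 ⊢
    rw [← h2]
    refine h3.trans (le_of_eq ?_)
    push_cast
    ring

/-- Playing only with probability `θ`. -/
lemma Play.null_mix (h : Play d E U p v f) {θ : ℝ} (h0 : 0 < θ) (h1 : θ ≤ 1) :
    Play d (fun φ => (1 - θ) * φ [] + θ * E φ) U p (θ * v) f := by
  have hE' : IsExpectation (requestSeqs U) (fun φ => (1 - θ) * φ [] + θ * E φ) :=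
    (IsExpectation.dirac (by simp [requestSeqs])).mix h.isExpectation h0.le h1
  refine ⟨hE', mul_pos h0 h.v_pos, ?_, h.f_pos, fun s hs A hA esc pre => ?_, fun n => ?_⟩
  · have := h.v_le
    have := h.v_pos
    nlinarith
  · have := h.game s hs A hA esc pre
    simp only [mssEscCostAux, mul_zero, zero_add]
    gcongr
  · have key : ∀ n m : ℕ, iterExp E m (fun u => iterExp (fun φ => (1 - θ) * φ [] + θ * E φ) n
        (fun w => freeOpt d U (u ++ w).flatten)) ≤ (m + n * θ) * (v / f) := by
      intro n
      induction n with
      | zero => intro m; simpa [iterExp] using h.offline m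
      | succ n ih =>
        intro m
        have hm := isExpectation_iterExp h.isExpectation m
        have e1 := ih m
        have e2 := ih (m + 1)
        rw [iterExp_succ_last] at e2
        simp only [iterExp]
        rw [hm.add, hm.const_mul, hm.const_mul]
        simp only [List.append_assoc, List.cons_append, List.nil_append] at e2
        simp only [List.flatten_append, List.flatten_cons, List.nil_append] at e1 e2 ⊢
        have e3 := mul_le_mul_of_nonneg_left e1 (sub_nonneg.2 h1)
        have e4 := mul_le_mul_of_nonneg_left e2 h0.le
        refine (add_le_add e3 e4).trans (le_of_eq ?_)
        push_cast
        ring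
    refine (key n 0).trans (le_of_eq ?_)
    push_cast
    ring

end online

/-- Expectation of `F i j`, where `j` is the number of successes and `i` the number of failures
in `n` independent trials of success probability `θ`. -/
def binExp (θ : ℝ) : ℕ → (ℕ → ℕ → ℝ) → ℝ
  | 0, F => F 0 0
  | n + 1, F =>
    (1 - θ) * binExp θ n (fun i j => F (i + 1) j) + θ * binExp θ n (fun i j => F i (j + 1))

section binExp

variable {θ : ℝ}

lemma binExp_add (n : ℕ) (F F' : ℕ → ℕ → ℝ) :
    binExp θ n (fun i j => F i j + F' i j) = binExp θ n F + binExp θ n F' := by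
  induction n generalizing F F' with
  | zero => rfl
  | succ n ih => simp only [binExp, ih]; ring

lemma binExp_const_mul (n : ℕ) (c : ℝ) (F : ℕ → ℕ → ℝ) :
    binExp θ n (fun i j => c * F i j) = c * binExp θ n F := by
  induction n generalizing F with
  | zero => rfl
  | succ n ih => simp only [binExp, ih]; ring

lemma binExp_const (n : ℕ) (c : ℝ) : binExp θ n (fun _ _ => c) = c := by
  induction n with
  | zero => rfl
  | succ n ih => simp only [binExp, ih]; ring

lemma binExp_failures (n : ℕ) : binExp θ n (fun i _ => (i : ℝ)) = n * (1 - θ) := by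
  induction n with
  | zero => simp [binExp]
  | succ n ih =>
    simp only [binExp]
    push_cast
    rw [binExp_add, binExp_const, ih]
    ring

lemma binExp_mono (h0 : 0 ≤ θ) (h1 : θ ≤ 1) (n : ℕ) {F F' : ℕ → ℕ → ℝ}
    (h : ∀ i j, i + j = n → F i j ≤ F' i j) : binExp θ n F ≤ binExp θ n F' := by
  induction n generalizing F F' with
  | zero => exact h 0 0 rfl
  | succ n ih =>
    simp only [binExp]
    have e1 := ih (F := fun i j => F (i + 1) j) (F' := fun i j => F' (i + 1) j)
      fun i j hij => h _ _ (by omega)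
    have e2 := ih (F := fun i j => F i (j + 1)) (F' := fun i j => F' i (j + 1))
      fun i j hij => h _ _ (by omega)
    have := sub_nonneg.2 h1
    gcongr

lemma IsExpectation.binExp {α : Type*} {G : Set α} {E : (α → ℝ) → ℝ} (hE : IsExpectation G E)
    (n : ℕ) (F : α → ℕ → ℕ → ℝ) :
    E (fun a => binExp θ n (F a)) = _root_.binExp θ n (fun i j => E (fun a => F a i j)) := by
  induction n generalizing F with
  | zero => rfl
  | succ n ih =>
    simp only [_root_.binExp]
    rw [hE.add, hE.const_mul, hE.const_mul, ih, ih]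

end binExp

section decouple

variable {α β : Type*} {G : Set α} {G' : Set β} {E : (α → ℝ) → ℝ} {E' : (β → ℝ) → ℝ} {θ : ℝ}

/-- The letters of the first kind in a word. -/
def leftLetters (w : List (α ⊕ β)) : List α := w.filterMap Sum.getLeft?

/-- The letters of the second kind in a word. -/
def rightLetters (w : List (α ⊕ β)) : List β := w.filterMap Sum.getRight?

/-- A random letter, of the second kind with probability `θ`. -/
def sumExp (θ : ℝ) (E : (α → ℝ) → ℝ) (E' : (β → ℝ) → ℝ) (φ : α ⊕ β → ℝ) : ℝ :=
  (1 - θ) * E (fun a => φ (Sum.inl a)) + θ * E' (fun b => φ (Sum.inr b))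

lemma isExpectation_sumExp (hE : IsExpectation G E) (hE' : IsExpectation G' E') (h0 : 0 ≤ θ)
    (h1 : θ ≤ 1) :
    IsExpectation {x : α ⊕ β | x.elim (· ∈ G) (· ∈ G')} (sumExp θ E E') :=
  (hE.map (f := Sum.inl) (by simp)).mix (hE'.map (f := Sum.inr) (by simp)) h0 h1

/-- In a random word, the letters of both kinds are independent of the pattern of kinds. -/
lemma iterExp_sumExp (hE : IsExpectation G E) (hE' : IsExpectation G' E') (n : ℕ)
    (χ : List α → List β → ℝ) :
    iterExp (sumExp θ E E') n (fun w => χ (leftLetters w) (rightLetters w)) =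
      binExp θ n (fun i j => iterExp E i (fun s => iterExp E' j (fun t => χ s t))) := by
  induction n generalizing χ with
  | zero => rfl
  | succ n ih =>
    have e1 : ∀ a, iterExp (sumExp θ E E') n (fun w => χ (leftLetters (Sum.inl a :: w))
        (rightLetters (Sum.inl a :: w))) = _ := fun a => ih (fun s t => χ (a :: s) t)
    have e2 : ∀ b, iterExp (sumExp θ E E') n (fun w => χ (leftLetters (Sum.inr b :: w))
        (rightLetters (Sum.inr b :: w))) = _ := fun b => ih (fun s t => χ s (b :: t))
    rw [iterExp, sumExp]
    simp only [e1, e2]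
    rw [hE.binExp, hE'.binExp]
    have e3 : ∀ i j, E' (fun b => iterExp E i fun s => iterExp E' j fun t => χ s (b :: t)) =
        iterExp E i fun s => iterExp E' (j + 1) fun t => χ s t := fun i j =>
      hE'.swap (isExpectation_iterExp hE i) _
    simp only [e3]
    rfl

/-- Cost of processing phases of letters: the first-kind letters of phases with more than `b`
letters of the second kind are collected and eventually charged by `g`; every other phase is
charged `c` plus a cost of its second-kind letters. -/
noncomputable def phaseCost (b : ℕ) (c : ℝ) (g : List α → ℝ) (cT : List β → ℝ) :
    List α → List (List (α ⊕ β)) → ℝ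
  | u, [] => g u
  | u, w :: ws =>
    if (rightLetters w).length ≤ b then phaseCost b c g cT u ws + (c + cT (rightLetters w))
    else phaseCost b c g cT (u ++ leftLetters w) ws

lemma iterExp_phaseCost_le (hE : IsExpectation G E) (hE' : IsExpectation G' E') (h0 : 0 ≤ θ)
    (h1 : θ ≤ 1) {g : List α → ℝ} {cT : List β → ℝ} {x y : ℝ}
    (hg : ∀ m : ℕ, iterExp E m g ≤ m * x) (hT : ∀ m : ℕ, iterExp E' m cT ≤ m * y)
    (b H : ℕ) (c : ℝ) (q m : ℕ) :
    iterExp E m (fun u => iterExp (iterExp (sumExp θ E E') H) q (phaseCost b c g cT u)) ≤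
      m * x + q * binExp θ H (fun i j => if j ≤ b then c + j * y else i * x) := by
  induction q generalizing m with
  | zero => simpa [iterExp, phaseCost] using hg m
  | succ q ih =>
    have hEE := isExpectation_sumExp (θ := θ) hE hE' h0 h1
    have hq := isExpectation_iterExp (isExpectation_iterExp hEE H) q
    have hm := isExpectation_iterExp hE m
    set X := binExp θ H (fun i j => if j ≤ b then c + j * y else i * x) with hX
    set B : List α → ℝ := fun u =>
      iterExp (iterExp (sumExp θ E E') H) q (phaseCost b c g cT u) with hB
    have e1 : ∀ u, iterExp (iterExp (sumExp θ E E') H) (q + 1) (phaseCost b c g cT u) =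
        binExp θ H (fun i j => if j ≤ b then B u + (c + iterExp E' j cT)
          else iterExp E i (fun s => B (u ++ s))) := by
      intro u
      have e2 : ∀ w, iterExp (iterExp (sumExp θ E E') H) q
          (fun ws => phaseCost b c g cT u (w :: ws)) =
          (fun (s : List α) (t : List β) => if t.length ≤ b then B u + (c + cT t)
            else B (u ++ s)) (leftLetters w) (rightLetters w) := by
        intro w
        simp only [phaseCost]
        split_ifs
        · rw [hq.add, hq.const]
        · rfl
      rw [iterExp]
      simp only [e2]
      refine (iterExp_sumExp hE hE' H (fun s t => if t.length ≤ b then B u + (c + cT t)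
            else B (u ++ s))).trans ?_
      congr 1
      funext i j
      have hj := isExpectation_iterExp hE' j
      have hi := isExpectation_iterExp hE i
      by_cases hb : j ≤ b
      · rw [if_pos hb, ← hi.const (B u + (c + iterExp E' j cT))]
        congr 1
        funext s
        rw [hj.congr (ψ := fun t => B u + (c + cT t)) (by rintro t ⟨ht, -⟩; simp [ht, hb]),
          hj.const_add, hj.const_add]
      · rw [if_neg hb]
        congr 1
        funext s
        rw [hj.congr (ψ := fun t => B (u ++ s)) (by rintro t ⟨ht, -⟩; simp [ht, hb]), hj.const]
    simp only [e1]
    rw [hm.binExp]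
    have e3 : m * x + (q + 1 : ℕ) * X = binExp θ H (fun i j =>
        (m * x + q * X) + (if j ≤ b then c + j * y else i * x)) := by
      rw [binExp_add, binExp_const, ← hX]
      push_cast
      ring
    rw [e3]
    refine binExp_mono h0 h1 H fun i j _ => ?_
    by_cases hb : j ≤ b
    · simp only [if_pos hb]
      rw [hm.add, hm.const]
      exact add_le_add (ih m) (add_le_add le_rfl (hT j))
    · simp only [if_neg hb]
      have := ih (m + i)
      rw [iterExp_add] at this
      refine this.trans (le_of_eq ?_)
      push_cast
      ring

end decouple

section merge

variable {M : Type*} {d : M → M → ℝ} {S T : Finset M}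

lemma dpOpt_map_union_append_le {σ τ : List (Finset M)}
    (h : ∀ s ∈ S, dpOpt d s σ ≤ dpOpt d s τ) {a : List (Finset M)} (ha : a ∈ requestSeqs S)
    {s : M} (hs : s ∈ S) : dpOpt d s (a.map (· ∪ T) ++ σ) ≤ dpOpt d s (a ++ τ) := by
  induction a generalizing s with
  | nil => exact h s hs
  | cons r a ih =>
    obtain ⟨y, hy, e⟩ := exists_dpOpt_cons (d := d) (s := s) (ha r (by simp)).1 (a ++ τ)
    have e1 := ih (fun q hq => ha q (by simp [hq])) ((ha r (by simp)).2 hy)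
    have e2 := dpOpt_cons_le (d := d) (s := s) (Finset.mem_union_left T hy)
      (a.map (· ∪ T) ++ σ)
    simp only [List.map_cons, List.cons_append]
    linarith

lemma dpOpt_stay_append_le (hd : IsMetric d) (b σ : List (Finset M)) {s : M} (hs : s ∈ S) :
    dpOpt d s (b.map (· ∪ S) ++ σ) ≤ dpOpt d s σ := by
  induction b with
  | nil => exact le_rfl
  | cons r b ih =>
    have e2 := dpOpt_cons_le (d := d) (s := s) (Finset.mem_union_right r hs)
      (b.map (· ∪ S) ++ σ)
    have := (hd.1 s s).2 rfl
    simp only [List.map_cons, List.cons_append]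
    linarith

/-- The requests in `S ∪ T` encoded by a letter: requests in one part are extended by the whole
other part. -/
noncomputable def unionLetter (S T : Finset M) (x : List (Finset M) ⊕ List (Finset M)) :
    List (Finset M) :=
  x.elim (·.map (· ∪ T)) (·.map (· ∪ S))

lemma freeOpt_unionLetter_le_left (hd : IsMetric d) (hS : S.Nonempty)
    {z : List (List (Finset M) ⊕ List (Finset M))}
    (hz : ∀ a ∈ leftLetters z, a ∈ requestSeqs S) :
    freeOpt d (S ∪ T) (z.map (unionLetter S T)).flatten ≤ freeOpt d S (leftLetters z).flatten := by
  have key : ∀ s ∈ S, dpOpt d s (z.map (unionLetter S T)).flatten ≤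
      dpOpt d s (leftLetters z).flatten := by
    induction z with
    | nil => exact fun _ _ => le_rfl
    | cons x z ih =>
      intro s hs
      cases x with
      | inl a =>
        exact dpOpt_map_union_append_le
          (ih fun q hq => hz q (List.mem_cons_of_mem _ hq)) (hz a (List.mem_cons_self ..)) hs
      | inr b => exact (dpOpt_stay_append_le hd b _ hs).trans (ih hz s hs)
  obtain ⟨s, hs, h⟩ := exists_freeOpt (d := d) hS (leftLetters z).flatten
  rw [h]
  exact (freeOpt_le (Finset.mem_union_left T hs) _).trans (key s hs)

lemma freeOpt_unionLetter_le_right (hd : IsMetric d) (hT : T.Nonempty)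
    {z : List (List (Finset M) ⊕ List (Finset M))}
    (hz : ∀ b ∈ rightLetters z, b ∈ requestSeqs T) :
    freeOpt d (S ∪ T) (z.map (unionLetter S T)).flatten ≤
      freeOpt d T (rightLetters z).flatten := by
  have key : ∀ s ∈ T, dpOpt d s (z.map (unionLetter S T)).flatten ≤
      dpOpt d s (rightLetters z).flatten := by
    induction z with
    | nil => exact fun _ _ => le_rfl
    | cons x z ih =>
      intro s hs
      cases x with
      | inr a =>
        exact dpOpt_map_union_append_le
          (ih fun q hq => hz q (List.mem_cons_of_mem _ hq)) (hz a (List.mem_cons_self ..)) hs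
      | inl b => exact (dpOpt_stay_append_le hd b _ hs).trans (ih hz s hs)
  obtain ⟨s, hs, h⟩ := exists_freeOpt (d := d) hT (rightLetters z).flatten
  rw [h]
  exact (freeOpt_le (Finset.mem_union_right S hs) _).trans (key s hs)

/-- Letters encoding request sequences in `S`, or taken from `G`. -/
def properLetters (S : Finset M) (G : Set (List (Finset M))) :
    Set (List (Finset M) ⊕ List (Finset M)) :=
  {x | x.elim (· ∈ requestSeqs S) (· ∈ G)}

lemma unionLetter_mem (hS : S.Nonempty) {G : Set (List (Finset M))}
    (hG : ∀ b ∈ G, ∀ r ∈ b, r ⊆ T) {x : List (Finset M) ⊕ List (Finset M)}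
    (hx : x ∈ properLetters S G) : unionLetter S T x ∈ requestSeqs (S ∪ T) := by
  intro r hr
  cases x with
  | inl a =>
    obtain ⟨q, hq, rfl⟩ := List.mem_map.1 hr
    have := hx q hq
    exact ⟨this.1.mono Finset.subset_union_left, Finset.union_subset_union_left this.2⟩
  | inr b =>
    obtain ⟨q, hq, rfl⟩ := List.mem_map.1 hr
    have := hG b hx q hq
    refine ⟨hS.mono Finset.subset_union_right, ?_⟩
    rw [Finset.union_comm]
    exact Finset.union_subset_union_right this

lemma map_unionLetter_mem (hS : S.Nonempty) {G : Set (List (Finset M))}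
    (hG : ∀ b ∈ G, ∀ r ∈ b, r ⊆ T) {z : List (List (Finset M) ⊕ List (Finset M))}
    (hz : ∀ x ∈ z, x ∈ properLetters S G) :
    (z.map (unionLetter S T)).flatten ∈ requestSeqs (S ∪ T) := by
  refine flatten_mem_requestSeqs fun σ hσ => ?_
  obtain ⟨x, hx, rfl⟩ := List.mem_map.1 hσ
  exact unionLetter_mem hS hG (hz x hx)

lemma mem_of_mem_leftLetters {G : Set (List (Finset M))}
    {z : List (List (Finset M) ⊕ List (Finset M))} (hz : ∀ x ∈ z, x ∈ properLetters S G)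
    {a : List (Finset M)} (ha : a ∈ leftLetters z) :
    a ∈ requestSeqs S := by
  obtain ⟨x, hx, h⟩ := List.mem_filterMap.1 ha
  have := hz x hx
  cases x with
  | inl a' => cases h; exact this
  | inr b => simp at h

lemma mem_of_mem_rightLetters {G : Set (List (Finset M))}
    {z : List (List (Finset M) ⊕ List (Finset M))} (hz : ∀ x ∈ z, x ∈ properLetters S G)
    {b : List (Finset M)} (hb : b ∈ rightLetters z) : b ∈ G := by
  obtain ⟨x, hx, h⟩ := List.mem_filterMap.1 hb
  have := hz x hx
  cases x with
  | inr b' => cases h; exact this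
  | inl a => simp at h

lemma freeOpt_le_phaseCost (hd : IsMetric d) (hS : S.Nonempty) {G : Set (List (Finset M))}
    (hG : ∀ b ∈ G, ∀ r ∈ b, r ⊆ T) {Δ : ℝ} (hΔ : ∀ x ∈ S ∪ T, ∀ y ∈ S ∪ T, d x y ≤ Δ)
    {cT : List (List (Finset M)) → ℝ}
    (hcT : ∀ z : List (List (Finset M) ⊕ List (Finset M)), (∀ x ∈ z, x ∈ properLetters S G) →
      freeOpt d (S ∪ T) (z.map (unionLetter S T)).flatten ≤ cT (rightLetters z))
    (b : ℕ) {ws : List (List (List (Finset M) ⊕ List (Finset M)))}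
    (hws : ∀ w ∈ ws, ∀ x ∈ w, x ∈ properLetters S G)
    {z : List (List (Finset M) ⊕ List (Finset M))} (hz : ∀ x ∈ z, x ∈ properLetters S G) :
    freeOpt d (S ∪ T) ((z ++ ws.flatten).map (unionLetter S T)).flatten ≤
      phaseCost b (2 * Δ) (fun u => freeOpt d S u.flatten) cT (leftLetters z) ws := by
  induction ws generalizing z with
  | nil =>
    simp only [List.flatten_nil, List.append_nil, phaseCost]
    exact freeOpt_unionLetter_le_left hd hS fun a ha => mem_of_mem_leftLetters hz ha
  | cons w ws ih =>
    have hw := hws w (by simp)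
    have hws' : ∀ w ∈ ws, ∀ x ∈ w, x ∈ properLetters S G := fun w hw => hws w (by simp [hw])
    rw [phaseCost]
    split_ifs
    · have e1 := ih hws' hz
      have e2 := hcT w hw
      have e3 := freeOpt_detour_le hd (hS.mono Finset.subset_union_left) hΔ
        (map_unionLetter_mem hS hG hz) (map_unionLetter_mem hS hG hw)
        (map_unionLetter_mem hS hG (z := ws.flatten) (by
          intro x hx
          obtain ⟨w', hw', hx⟩ := List.mem_flatten.1 hx
          exact hws' w' hw' x hx))
      simp only [List.flatten_cons, List.map_append, List.flatten_append] at e1 e3 ⊢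
      linarith
    · have e1 := ih hws' (z := z ++ w) (by
        intro x hx
        rcases List.mem_append.1 hx with hx | hx
        exacts [hz x hx, hw x hx])
      simp only [List.flatten_cons, ← List.append_assoc]
      refine e1.trans (le_of_eq ?_)
      simp [leftLetters]

/-- Superadditivity of the free offline cost along independent blocks. -/
lemma mul_iterExp_freeOpt_le {U : Finset M} (hU : U.Nonempty) (hd : IsMetric d)
    {E : (List (Finset M) → ℝ) → ℝ} (hE : IsExpectation (requestSeqs U) E) (H n : ℕ) :
    H * iterExp E n (fun w => freeOpt d U w.flatten) ≤
      iterExp E (H * n) (fun w => freeOpt d U w.flatten) := by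
  induction H with
  | zero =>
    simp only [Nat.cast_zero, zero_mul, iterExp]
    exact freeOpt_nonneg hd _
  | succ H ih =>
    have hH := isExpectation_iterExp hE (H * n)
    have hn := isExpectation_iterExp hE n
    rw [Nat.succ_mul, iterExp_add]
    have : iterExp E (H * n) (fun w => freeOpt d U w.flatten) +
        iterExp E n (fun w => freeOpt d U w.flatten) ≤ iterExp E (H * n) (fun u =>
          iterExp E n (fun w => freeOpt d U (u ++ w).flatten)) := by
      rw [← hH.const (iterExp E n (fun w => freeOpt d U w.flatten)), ← hH.add]
      refine hH.mono fun u hu => ?_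
      rw [← hn.const_add]
      refine hn.mono fun w hw => ?_
      rw [List.flatten_append]
      exact freeOpt_append_ge hU (flatten_mem_requestSeqs hu.2) _
    push_cast
    linarith

/-- Probability of at most `b` successes in `n` independent trials. -/
noncomputable def binTail (θ : ℝ) (n b : ℕ) : ℝ := binExp θ n (fun _ j => if j ≤ b then 1 else 0)

lemma binTail_nonneg {θ : ℝ} (h0 : 0 ≤ θ) (h1 : θ ≤ 1) (n b : ℕ) : 0 ≤ binTail θ n b := by
  rw [← binExp_const (θ := θ) n 0]
  exact binExp_mono h0 h1 n fun i j _ => by split_ifs <;> simp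

lemma binExp_phase_le {θ x y Δ : ℝ} (h0 : 0 ≤ θ) (h1 : θ ≤ 1) (hx : 0 ≤ x) (hy : 0 ≤ y)
    {H b : ℕ} (hb : b ≤ H * θ) (h : 3 * Δ + b * y ≤ H * (1 - θ) * x) :
    binExp θ H (fun i j => if j ≤ b then 2 * Δ + j * y else i * x) ≤
      H * (1 - θ) * x - Δ * binTail θ H b := by
  have e : H * (1 - θ) * x - Δ * binTail θ H b =
      binExp θ H (fun i j => x * i + (-Δ) * (if j ≤ b then 1 else 0)) := by
    rw [binExp_add, binExp_const_mul, binExp_const_mul, binExp_failures, binTail]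
    ring
  rw [e]
  refine binExp_mono h0 h1 H fun i j hij => ?_
  split_ifs with hj
  · have e1 : (j : ℝ) ≤ b := by exact_mod_cast hj
    have e2 : (i : ℝ) + j = H := by exact_mod_cast hij
    have e3 : (j : ℝ) * y ≤ b * y := by gcongr
    have e4 : H * (1 - θ) * x ≤ i * x := by
      gcongr
      linarith
    linarith
  · linarith

/-- Mixing a play in `S` with a random request sequence in `T` of larger value, extended by all
points of `S`. -/
lemma Play.merge (hd : IsMetric d) {Δ ℓ vS vT F fT g θ : ℝ} {H b : ℕ}
    {E E' : (List (Finset M) → ℝ) → ℝ} (hS : S.Nonempty)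
    (hΔ : ∀ x ∈ S ∪ T, ∀ y ∈ S ∪ T, d x y ≤ Δ)
    (hℓ : ∀ x ∈ S, ∀ y ∈ T, ℓ ≤ d x y)
    (hplay : Play d E S ℓ vS F)
    {G : Set (List (Finset M))} (hG : ∀ b ∈ G, ∀ r ∈ b, r ⊆ T) (hE' : IsExpectation G E')
    (hgame : ∀ s ∈ T, Game d (fun φ => E' (fun b => φ (b.map (· ∪ S)))) ℓ vT s)
    {cT : List (List (Finset M)) → ℝ}
    (hcT : ∀ z : List (List (Finset M) ⊕ List (Finset M)), (∀ x ∈ z, x ∈ properLetters S G) →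
      freeOpt d (S ∪ T) (z.map (unionLetter S T)).flatten ≤ cT (rightLetters z))
    (hfT : 0 < fT) (hT : ∀ m : ℕ, iterExp E' m cT ≤ m * (vT / fT))
    (hvT : Δ / 8 ≤ vT) (hvT' : vT ≤ Δ) (hθ0 : 0 < θ) (hθ1 : θ < 1)
    (hθ : (1 - θ) * vS = θ * vT) (hH : 1 ≤ H) (hb : b ≤ H * θ)
    (h24 : 24 ≤ H * θ / F - b / fT) (hg0 : 0 ≤ g)
    (hg : g ≤ binTail θ H b * F ^ 2 / (H * θ)) :
    ∃ E'', Play d E'' (S ∪ T) ℓ ((1 - θ) * vS) (F + g) := by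
  obtain ⟨hE, hvS, hvSℓ, hF, hgameS, hoff⟩ := hplay
  have hEE := isExpectation_sumExp (θ := θ) hE hE' hθ0.le hθ1.le
  have hℓ0 : 0 ≤ ℓ := hvS.le.trans hvSℓ
  have h1θ : 0 < 1 - θ := sub_pos.2 hθ1
  have hH0 : (0 : ℝ) < H := by exact_mod_cast hH
  have hvT0 : 0 < vT := by
    have : 0 < θ * vT := hθ ▸ mul_pos h1θ hvS
    exact pos_of_mul_pos_right this hθ0.le
  have hUne : (S ∪ T).Nonempty := hS.mono Finset.subset_union_left
  set E'' : (List (Finset M) → ℝ) → ℝ := fun φ =>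
    sumExp θ E E' (fun x => φ (unionLetter S T x)) with hE''
  have hexp : IsExpectation (requestSeqs (S ∪ T)) E'' :=
    hEE.map fun x hx => unionLetter_mem hS hG hx
  refine ⟨E'', hexp, mul_pos h1θ hvS, ?_, by linarith, fun s hs A hA esc pre => ?_, fun n => ?_⟩
  · nlinarith
  · have hnn : ∀ σ, 0 ≤ mssEscCostAux d ℓ A esc pre s σ := mssEscCostAux_nonneg hd hℓ0 A esc pre s
    change _ ≤ (1 - θ) * E (fun a => mssEscCostAux d ℓ A esc pre s (a.map (· ∪ T))) +
      θ * E' (fun b => mssEscCostAux d ℓ A esc pre s (b.map (· ∪ S)))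
    rcases Finset.mem_union.1 hs with hs | hs
    · have e1 := Game.union hd hℓ0 hE hℓ hs (hgameS s hs) A hA esc pre
      have e2 := hE'.nonneg (φ := fun b => mssEscCostAux d ℓ A esc pre s (b.map (· ∪ S)))
        fun _ _ => hnn _
      have e3 := mul_le_mul_of_nonneg_left e1 h1θ.le
      have e4 := mul_nonneg hθ0.le e2
      linarith
    · have e1 := hgame s hs A hA esc pre
      have e2 := hE.nonneg (φ := fun b => mssEscCostAux d ℓ A esc pre s (b.map (· ∪ T)))
        fun _ _ => hnn _
      have e3 := mul_le_mul_of_nonneg_left e1 hθ0.le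
      have e4 := mul_nonneg h1θ.le e2
      linarith
  · have e1 := mul_iterExp_freeOpt_le hUne hd hexp H n
    have e2 : iterExp E'' (H * n) (fun w => freeOpt d (S ∪ T) w.flatten) ≤
        n * binExp θ H (fun i j => if j ≤ b then 2 * Δ + j * (vT / fT) else i * (vS / F)) := by
      have e3 := iterExp_phaseCost_le hE hE' hθ0.le hθ1.le hoff hT b H (2 * Δ) n 0
      simp only [iterExp, Nat.cast_zero, zero_mul, zero_add] at e3
      refine le_trans ?_ e3
      rw [iterExp_map, Nat.mul_comm, iterExp_mul]
      refine (isExpectation_iterExp (isExpectation_iterExp hEE H) n).mono fun ws hws => ?_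
      exact freeOpt_le_phaseCost hd hS hG hΔ hcT b (fun w hw => (hws.2 w hw).2) (z := []) (by simp)
    have e4 := binExp_phase_le (θ := θ) (x := vS / F) (y := vT / fT) (Δ := Δ) (H := H) (b := b)
      hθ0.le hθ1.le (by positivity) (by positivity) hb (by
        have : H * (1 - θ) * (vS / F) = vT * (H * θ / F) := by
          field_simp
          linarith
        rw [this]
        have := mul_le_mul_of_nonneg_left h24 hvT0.le
        have e : vT * (H * θ / F - b / fT) = vT * (H * θ / F) - b * (vT / fT) := by ring
        rw [e] at this
        linarith)
    set π := binTail θ H b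
    set X := binExp θ H (fun i j => if j ≤ b then 2 * Δ + j * (vT / fT) else i * (vS / F))
    have hπ : 0 ≤ π := binTail_nonneg hθ0.le hθ1.le H b
    have hv : 0 < (1 - θ) * vS := mul_pos h1θ hvS
    have e5 : X ≤ H * ((1 - θ) * vS / (F + g)) := by
      refine e4.trans ?_
      have hN : 0 < H * θ := mul_pos hH0 hθ0
      have hg' : g * (H * θ) ≤ π * F ^ 2 := by
        rwa [le_div_iff₀ hN] at hg
      have hFg : 0 < F + g := by linarith
      have : H * (1 - θ) * (vS / F) - Δ * π ≤ H * ((1 - θ) * vS) / F - vT * π := by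
        have : vT * π ≤ Δ * π := by gcongr
        have e : H * (1 - θ) * (vS / F) = H * ((1 - θ) * vS) / F := by ring
        linarith
      refine this.trans ?_
      rw [hθ, ← mul_div_assoc, le_div_iff₀ hFg]
      have e : (H * (θ * vT) / F - vT * π) * (F + g) =
          H * (θ * vT) + vT / F * (g * (H * θ) - π * F ^ 2) - vT * π * g := by
        field_simp
        ring
      rw [e]
      have : vT / F * (g * (H * θ) - π * F ^ 2) ≤ 0 :=
        mul_nonpos_of_nonneg_of_nonpos (by positivity) (by linarith)
      have : 0 ≤ vT * π * g := by positivity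
      linarith
    have e6 : (H : ℝ) * iterExp E'' n (fun w => freeOpt d (S ∪ T) w.flatten) ≤
        H * (n * ((1 - θ) * vS / (F + g))) := by
      refine (e1.trans e2).trans ?_
      have := mul_le_mul_of_nonneg_left e5 (Nat.cast_nonneg (α := ℝ) n)
      linarith
    exact le_of_mul_le_mul_left e6 hH0

end merge

section binTail

variable {θ : ℝ}

lemma binExp_tilt {θ' a b : ℝ} (ha : a * (1 - θ') = 1 - θ) (hb : b * θ' = θ) (n : ℕ)
    (F : ℕ → ℕ → ℝ) : binExp θ' n (fun i j => a ^ i * b ^ j * F i j) = binExp θ n F := by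
  induction n generalizing F with
  | zero => simp [binExp]
  | succ n ih =>
    have e1 : ∀ i j, a ^ (i + 1) * b ^ j * F (i + 1) j = a * (a ^ i * b ^ j * F (i + 1) j) :=
      fun i j => by ring
    have e2 : ∀ i j, a ^ i * b ^ (j + 1) * F i (j + 1) = b * (a ^ i * b ^ j * F i (j + 1)) :=
      fun i j => by ring
    simp only [binExp, e1, e2, binExp_const_mul, ih (fun i j => F (i + 1) j),
      ih (fun i j => F i (j + 1))]
    rw [← ha, ← hb]
    ring

lemma binExp_sq_sub (n : ℕ) (c : ℝ) :
    binExp θ n (fun _ j => ((j : ℝ) - c) ^ 2) = n * θ * (1 - θ) + (n * θ - c) ^ 2 := by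
  induction n generalizing c with
  | zero => simp [binExp]
  | succ n ih =>
    have e : ∀ j : ℕ, (((j + 1 : ℕ) : ℝ) - c) ^ 2 = ((j : ℝ) - (c - 1)) ^ 2 := fun j => by
      push_cast
      ring
    simp only [binExp, e, ih]
    push_cast
    ring

/-- Lower bound for moderate deviations below the mean. -/
lemma half_exp_le_binTail (h0 : 0 < θ) (h1 : θ ≤ 1 / 2) {H : ℕ} {η : ℝ} (hη0 : 0 < η)
    (hη : η ≤ 1 / 4) (hN : 2 ≤ H * θ * η ^ 2) :
    1 / 2 * Real.exp (-(12 * η ^ 2 * (H * θ))) ≤ binTail θ H ⌊H * θ * (1 - η)⌋₊ := by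
  set N : ℝ := H * θ with hNdef
  set x : ℝ := 2 * η with hx
  set θ' : ℝ := θ * (1 - x) with hθ'
  set y : ℝ := θ * x / (1 - θ) with hy
  have h1θ : 0 < 1 - θ := by linarith
  have h1x : 0 < 1 - x := by linarith
  have hy0 : 0 ≤ y := by rw [hy]; positivity
  have hyx : y ≤ x := by
    rw [hy, div_le_iff₀ h1θ]
    nlinarith
  have hN0 : 0 < N := by
    by_contra h
    push Not at h
    nlinarith [sq_nonneg η]
  have hb : (1 - x)⁻¹ * θ' = θ := by rw [hθ']; field_simp
  have ha : (1 + y)⁻¹ * (1 - θ') = 1 - θ := by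
    have : 1 - θ' = (1 + y) * (1 - θ) := by rw [hθ', hy]; field_simp; ring
    rw [this]
    field_simp
  have hθ'0 : 0 < θ' := mul_pos h0 h1x
  have hθ'1 : θ' ≤ 1 := by nlinarith
  set K := Real.exp (-(12 * η ^ 2 * N)) with hK
  rw [binTail, ← binExp_tilt ha hb]
  have key : binExp θ' H (fun _ j => K + (-(K / (N * η) ^ 2)) * ((j : ℝ) - N * (1 - x)) ^ 2) ≤
      binExp θ' H (fun i j => (1 + y)⁻¹ ^ i * (1 - x)⁻¹ ^ j *
        if j ≤ ⌊N * (1 - η)⌋₊ then 1 else 0) := by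
    refine binExp_mono hθ'0.le hθ'1 H fun i j hij => ?_
    have hK0 : 0 < K := Real.exp_pos _
    have hw : 0 ≤ (1 + y)⁻¹ ^ i * (1 - x)⁻¹ ^ j := by positivity
    have hNη : 0 < (N * η) ^ 2 := by positivity
    have e : K + (-(K / (N * η) ^ 2)) * ((j : ℝ) - N * (1 - x)) ^ 2 =
        K / (N * η) ^ 2 * ((N * η) ^ 2 - ((j : ℝ) - N * (1 - x)) ^ 2) := by
      field_simp
      ring
    by_cases hj : |(j : ℝ) - N * (1 - x)| ≤ N * η
    · obtain ⟨hj1, hj2⟩ := abs_le.1 hj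
      have hjN : (j : ℝ) ≤ N * (1 - η) := by rw [hx] at hj2; linarith
      rw [if_pos (Nat.le_floor hjN), mul_one]
      have hKle : K + (-(K / (N * η) ^ 2)) * ((j : ℝ) - N * (1 - x)) ^ 2 ≤ K := by
        have : 0 ≤ K / (N * η) ^ 2 * ((j : ℝ) - N * (1 - x)) ^ 2 := by positivity
        linarith
      refine hKle.trans ?_
      have e1 : Real.exp (-y) ≤ (1 + y)⁻¹ := by
        rw [Real.exp_neg]
        have := Real.add_one_le_exp y
        gcongr
        linarith
      have e2 : Real.exp x ≤ (1 - x)⁻¹ := by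
        have := Real.add_one_le_exp (-x)
        rw [← neg_neg x, Real.exp_neg, neg_neg]
        gcongr
        linarith
      have e3 : Real.exp (-y) ^ i * Real.exp x ^ j ≤ (1 + y)⁻¹ ^ i * (1 - x)⁻¹ ^ j := by
        gcongr
      refine le_trans ?_ e3
      rw [← Real.exp_nat_mul, ← Real.exp_nat_mul, ← Real.exp_add, hK]
      apply Real.exp_le_exp.2
      have hi : (i : ℝ) = H - j := by
        have : (i : ℝ) + j = H := by exact_mod_cast hij
        linarith
      have hyH : y * (H * (1 - θ)) = x * N := by rw [hy, hNdef]; field_simp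
      have e4 : i * -y + j * x = -((x + y) * (N - j)) := by
        rw [hi]
        have : (H : ℝ) * y = x * N + y * N := by rw [← hyH, hNdef]; ring
        linarith
      rw [e4]
      have e5 : 0 ≤ N - j := by nlinarith
      have e6 : N - j ≤ 3 * η * N := by rw [hx] at hj1; linarith
      have e7 : (x + y) * (N - j) ≤ (2 * x) * (3 * η * N) :=
        mul_le_mul (by linarith) e6 e5 (by linarith)
      rw [hx] at e7
      linarith
    · push Not at hj
      rw [e]
      refine le_trans ?_ (mul_nonneg hw (by split_ifs <;> norm_num))
      refine mul_nonpos_of_nonneg_of_nonpos (by positivity) ?_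
      have : (N * η) ^ 2 ≤ |(j : ℝ) - N * (1 - x)| ^ 2 := by gcongr
      rw [sq_abs] at this
      linarith
  refine le_trans ?_ key
  rw [binExp_add, binExp_const, binExp_const_mul, binExp_sq_sub]
  have e1 : (H : ℝ) * θ' = N * (1 - x) := by rw [hθ', hNdef]; ring
  rw [e1]
  have e2 : N * (1 - x) * (1 - θ') ≤ N := by
    have : (1 - x) * (1 - θ') ≤ 1 := by nlinarith
    nlinarith
  have e3 : N * (1 - x) * (1 - θ') / (N * η) ^ 2 ≤ 1 / 2 := by
    rw [div_le_iff₀ (by positivity)]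
    nlinarith
  have hK0 : 0 < K := Real.exp_pos _
  have e4 : K + -(K / (N * η) ^ 2) * (N * (1 - x) * (1 - θ') + (N * (1 - x) - N * (1 - x)) ^ 2) =
      K - K * (N * (1 - x) * (1 - θ') / (N * η) ^ 2) := by ring
  rw [e4]
  nlinarith

lemma binTail_zero (n : ℕ) : binTail θ n 0 = (1 - θ) ^ n := by
  induction n with
  | zero => simp [binTail, binExp]
  | succ n ih =>
    rw [binTail] at ih ⊢
    simp only [binExp, Nat.le_zero_eq, Nat.add_eq_zero_iff, one_ne_zero, and_false, if_false,
      binExp_const, mul_zero, add_zero] at ih ⊢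
    rw [ih, pow_succ, mul_comm]

/-- The constant in the growth rate of the offline advantage. -/
noncomputable def growthRate : ℝ := Real.exp (-1200) / 256

lemma growthRate_pos : 0 < growthRate := by unfold growthRate; positivity

lemma growthRate_le : growthRate ≤ 1 / 1200 := by
  unfold growthRate
  have := Real.add_one_le_exp 1200
  rw [Real.exp_neg, div_le_iff₀ (by norm_num)]
  have h : (Real.exp 1200)⁻¹ ≤ (1200 : ℝ)⁻¹ := by gcongr; linarith
  linarith

lemma growthRate_mul_exp_le {g : ℝ} (hg : 0 ≤ g) :
    growthRate * Real.exp (-(g / growthRate)) ≤ 1 / 256 * Real.exp (-(1200 * (g + 1))) := by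
  have h1 : 1200 * g ≤ g / growthRate := by
    rw [le_div_iff₀ growthRate_pos]
    have := growthRate_le
    nlinarith
  have h2 : Real.exp (-(g / growthRate)) ≤ Real.exp (-(1200 * g)) := by
    apply Real.exp_le_exp.2
    linarith
  have h3 : Real.exp (-(1200 * (g + 1))) = Real.exp (-1200) * Real.exp (-(1200 * g)) := by
    rw [← Real.exp_add]
    ring_nf
  rw [h3]
  have h4 := mul_le_mul_of_nonneg_left h2 growthRate_pos.le
  refine h4.trans (le_of_eq ?_)
  unfold growthRate
  ring

/-- Choice of the phase length and the threshold in a merge step. -/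
lemma exists_phase_length {F fT : ℝ} (hF : 1 / 8 ≤ F) (hfT : 0 < fT) (hle : fT ≤ F)
    (h0 : 0 < θ) (h1 : θ ≤ 1 / 2) :
    ∃ H b : ℕ, 1 ≤ H ∧ b ≤ H * θ ∧ 24 ≤ H * θ / F - b / fT ∧
      growthRate * Real.exp (-((F - fT) / growthRate)) ≤ binTail θ H b * F ^ 2 / (H * θ) := by
  obtain ⟨g, hg⟩ : ∃ g, g = F - fT := ⟨_, rfl⟩
  have hg0 : 0 ≤ g := by linarith
  rw [← hg]
  have hF0 : 0 < F := by linarith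
  by_cases hA : g + 1 ≤ F / 8
  · set H := ⌈24 * F ^ 2 / ((g + 1) * θ)⌉₊ with hH
    set η := 2 * (g + 1) / F with hη
    have hηpos : 0 < η := by positivity
    have hη4 : η ≤ 1 / 4 := by
      rw [hη, div_le_iff₀ hF0]
      linarith
    have hN1 : 24 * F ^ 2 / (g + 1) ≤ H * θ := by
      have := Nat.le_ceil (24 * F ^ 2 / ((g + 1) * θ))
      rw [div_le_iff₀ (by positivity)] at this ⊢
      linarith
    have hN2 : H * θ ≤ 25 * F ^ 2 / (g + 1) := by
      have h2 := (Nat.ceil_lt_add_one (a := 24 * F ^ 2 / ((g + 1) * θ)) (by positivity)).le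
      have h3 := mul_le_mul_of_nonneg_right h2 h0.le
      refine h3.trans ?_
      have h4 : (24 * F ^ 2 / ((g + 1) * θ) + 1) * θ = 24 * F ^ 2 / (g + 1) + θ := by
        field_simp
      rw [h4]
      have h5 : θ ≤ F ^ 2 / (g + 1) := by
        rw [le_div_iff₀ (by positivity)]
        nlinarith
      have h6 : 25 * F ^ 2 / (g + 1) = 24 * F ^ 2 / (g + 1) + F ^ 2 / (g + 1) := by ring
      linarith
    have hNpos : 0 < H * θ := lt_of_lt_of_le (by positivity) hN1
    have hNη1 : 96 * (g + 1) ≤ H * θ * η ^ 2 := by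
      have := mul_le_mul_of_nonneg_right hN1 (sq_nonneg η)
      refine le_trans (le_of_eq ?_) this
      rw [hη]
      field_simp
      ring
    have hNη2 : H * θ * η ^ 2 ≤ 100 * (g + 1) := by
      have := mul_le_mul_of_nonneg_right hN2 (sq_nonneg η)
      refine this.trans (le_of_eq ?_)
      rw [hη]
      field_simp
      ring
    have htail := half_exp_le_binTail h0 h1 hηpos hη4 (by linarith)
    have hfloor : (⌊H * θ * (1 - η)⌋₊ : ℝ) ≤ H * θ * (1 - η) := Nat.floor_le (by nlinarith)
    refine ⟨H, ⌊H * θ * (1 - η)⌋₊, ?_, ?_, ?_, ?_⟩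
    · by_contra h
      have : H = 0 := by omega
      rw [this] at hNpos
      simp at hNpos
    · nlinarith
    · have e1 : (⌊H * θ * (1 - η)⌋₊ : ℝ) / fT ≤ H * θ * (1 - η) / fT := by gcongr
      have e2 : H * θ / F - H * θ * (1 - η) / fT = H * θ * (g + 2) / (F * fT) := by
        have : fT = F - g := by linarith
        have h' : F - g ≠ 0 := by linarith
        rw [hη, this]
        field_simp
        ring
      have e3 : 24 ≤ H * θ * (g + 2) / (F * fT) := by
        rw [le_div_iff₀ (by positivity)]
        rw [div_le_iff₀ (by positivity)] at hN1
        nlinarith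
      linarith
    · refine (growthRate_mul_exp_le hg0).trans ?_
      rw [le_div_iff₀ hNpos]
      have e1 : Real.exp (-(1200 * (g + 1))) ≤ Real.exp (-(12 * η ^ 2 * (H * θ))) := by
        apply Real.exp_le_exp.2
        linarith
      have e2 := Real.exp_pos (-(1200 * (g + 1)))
      have e3 : H * θ ≤ 25 * F ^ 2 := hN2.trans (div_le_self (by positivity) (by linarith))
      have e4 : 1 / 2 * Real.exp (-(1200 * (g + 1))) * F ^ 2 ≤
          binTail θ H ⌊H * θ * (1 - η)⌋₊ * F ^ 2 := by
        gcongr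
        linarith
      refine le_trans ?_ e4
      have e5 := mul_le_mul_of_nonneg_left e3 e2.le
      have e6 : 0 ≤ Real.exp (-(1200 * (g + 1))) * F ^ 2 := by positivity
      linarith
  · push Not at hA
    set H := ⌈24 * F / θ⌉₊ with hH
    have hN1 : 24 * F ≤ H * θ := by
      have := Nat.le_ceil (24 * F / θ)
      rwa [div_le_iff₀ h0] at this
    have hN2 : H * θ ≤ 24 * F + 1 := by
      have h2 := (Nat.ceil_lt_add_one (a := 24 * F / θ) (by positivity)).le
      have h3 := mul_le_mul_of_nonneg_right h2 h0.le
      refine h3.trans ?_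
      have h4 : (24 * F / θ + 1) * θ = 24 * F + θ := by field_simp
      linarith
    have hNpos : 0 < H * θ := lt_of_lt_of_le (by positivity) hN1
    refine ⟨H, 0, ?_, by simpa using hNpos.le, ?_, ?_⟩
    · by_contra h
      have : H = 0 := by omega
      rw [this] at hNpos
      simp at hNpos
    · simp only [Nat.cast_zero, zero_div, sub_zero]
      rwa [le_div_iff₀ hF0]
    · refine (growthRate_mul_exp_le hg0).trans ?_
      rw [le_div_iff₀ hNpos, binTail_zero]
      have e1 : Real.exp (-(2 * θ)) ≤ 1 - θ := by
        rw [Real.exp_neg, inv_le_comm₀ (Real.exp_pos _) (by linarith)]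
        have := Real.add_one_le_exp (2 * θ)
        refine le_trans ?_ this
        rw [inv_le_iff_one_le_mul₀ (by linarith)]
        nlinarith
      have e2 : Real.exp (-(2 * θ)) ^ H ≤ (1 - θ) ^ H := by gcongr
      rw [← Real.exp_nat_mul] at e2
      have e3 : Real.exp (-(1200 * (g + 1))) ≤ Real.exp (H * -(2 * θ)) := by
        apply Real.exp_le_exp.2
        linarith
      have e4 : 1 / 256 * (H * θ) ≤ F ^ 2 := by nlinarith
      have e5 := Real.exp_pos (-(1200 * (g + 1)))
      calc 1 / 256 * Real.exp (-(1200 * (g + 1))) * (H * θ)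
          = Real.exp (-(1200 * (g + 1))) * (1 / 256 * (H * θ)) := by ring
        _ ≤ (1 - θ) ^ H * F ^ 2 :=
          mul_le_mul (e3.trans e2) e4 (by positivity) (pow_nonneg (by linarith) _)

end binTail

section good

variable {M : Type*} {d : M → M → ℝ} {S T : Finset M}

/-- A merge step with optimized phase lengths: the exponentials of the offline advantages add. -/
lemma Play.merge_exp (hd : IsMetric d) {Δ ℓ vS vT F fT : ℝ}
    {E E' : (List (Finset M) → ℝ) → ℝ} (hS : S.Nonempty)
    (hΔ : ∀ x ∈ S ∪ T, ∀ y ∈ S ∪ T, d x y ≤ Δ)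
    (hℓ : ∀ x ∈ S, ∀ y ∈ T, ℓ ≤ d x y)
    (hplay : Play d E S ℓ vS F) {G : Set (List (Finset M))} (hG : ∀ b ∈ G, ∀ r ∈ b, r ⊆ T)
    (hE' : IsExpectation G E')
    (hgame : ∀ s ∈ T, Game d (fun φ => E' (fun b => φ (b.map (· ∪ S)))) ℓ vT s)
    {cT : List (List (Finset M)) → ℝ}
    (hcT : ∀ z : List (List (Finset M) ⊕ List (Finset M)), (∀ x ∈ z, x ∈ properLetters S G) →
      freeOpt d (S ∪ T) (z.map (unionLetter S T)).flatten ≤ cT (rightLetters z))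
    (hT : ∀ m : ℕ, iterExp E' m cT ≤ m * (vT / fT))
    (hvT0 : 0 < vT) (hvT : Δ / 8 ≤ vT) (hvT' : vT ≤ Δ) (hF : 1 / 8 ≤ F) (hfT : 0 < fT)
    (hle : fT ≤ F) :
    ∃ E v f, Play d E (S ∪ T) ℓ v f ∧ 1 / 8 ≤ f ∧
      Real.exp (F / growthRate) + Real.exp (fT / growthRate) ≤ Real.exp (f / growthRate) := by
  have hvS := hplay.v_pos
  obtain ⟨v, hv0, hvS', hvT''⟩ : ∃ v, 0 < v ∧ v ≤ vS ∧ v ≤ vT :=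
    ⟨min vS vT, lt_min hvS hvT0, min_le_left _ _, min_le_right _ _⟩
  have hplay' := hplay.null_mix (θ := v / vS) (by positivity) ((div_le_one hvS).2 hvS')
  rw [div_mul_cancel₀ _ hvS.ne'] at hplay'
  set θ := v / (v + vT) with hθ
  have hθ0 : 0 < θ := by positivity
  have hθ1 : θ ≤ 1 / 2 := by
    rw [hθ, div_le_iff₀ (by positivity)]
    linarith
  obtain ⟨H, b, hH, hb, h24, hg⟩ := exists_phase_length hF hfT hle hθ0 hθ1
  set g := growthRate * Real.exp (-((F - fT) / growthRate)) with hgdef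
  have hg0 : 0 < g := mul_pos growthRate_pos (Real.exp_pos _)
  obtain ⟨E'', hE''⟩ := Play.merge hd hS hΔ hℓ hplay' hG hE' hgame hcT hfT hT hvT hvT' hθ0
    (by linarith) (by rw [hθ]; field_simp; ring) hH hb h24 hg0.le hg
  refine ⟨E'', _, F + g, hE'', by linarith, ?_⟩
  have e1 : (F + g) / growthRate = F / growthRate + Real.exp (-((F - fT) / growthRate)) := by
    rw [hgdef]
    field_simp [growthRate_pos.ne']
  have e2 : Real.exp (fT / growthRate) =
      Real.exp (F / growthRate) * Real.exp (-((F - fT) / growthRate)) := by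
    rw [← Real.exp_add]
    ring_nf
  have e3 := Real.add_one_le_exp (Real.exp (-((F - fT) / growthRate)))
  rw [e1, Real.exp_add, e2]
  have := mul_le_mul_of_nonneg_left e3 (Real.exp_pos (F / growthRate)).le
  linarith

lemma Play.merge_play (hd : IsMetric d) {Δ ℓ vS vT F fT : ℝ}
    {E E' : (List (Finset M) → ℝ) → ℝ} (hS : S.Nonempty) (hT : T.Nonempty)
    (hΔ : ∀ x ∈ S ∪ T, ∀ y ∈ S ∪ T, d x y ≤ Δ)
    (hℓ : ∀ x ∈ S, ∀ y ∈ T, ℓ ≤ d x y)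
    (hplay : Play d E S ℓ vS F) (hplay' : Play d E' T ℓ vT fT)
    (hvT : Δ / 8 ≤ vT) (hF : 1 / 8 ≤ F) (hle : fT ≤ F) :
    ∃ E v f, Play d E (S ∪ T) ℓ v f ∧ 1 / 8 ≤ f ∧
      Real.exp (F / growthRate) + Real.exp (fT / growthRate) ≤ Real.exp (f / growthRate) := by
  have hℓ' : ∀ x ∈ T, ∀ y ∈ S, ℓ ≤ d x y := fun x hx y hy => by rw [hd.2.1]; exact hℓ y hy x hx
  have hℓ0 : 0 ≤ ℓ := hplay.v_pos.le.trans hplay.v_le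
  obtain ⟨x, hx⟩ := hS
  obtain ⟨y, hy⟩ := hT
  refine Play.merge_exp hd ⟨x, hx⟩ hΔ hℓ hplay (G := requestSeqs T) (fun b hb r hr => (hb r hr).2)
    hplay'.isExpectation
    (fun s hs => Game.union hd hℓ0 hplay'.isExpectation hℓ' hs (hplay'.game s hs))
    (cT := fun t => freeOpt d T t.flatten)
    (fun z hz => freeOpt_unionLetter_le_right hd ⟨y, hy⟩ fun b hb => mem_of_mem_rightLetters hz hb)
    hplay'.offline hplay'.v_pos hvT ?_ hF hplay'.f_pos hle
  have e1 := hΔ x (Finset.mem_union_left _ hx) y (Finset.mem_union_right _ hy)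
  have e2 := hℓ x hx y hy
  have e3 := hplay'.v_le
  linarith

lemma Play.merge_singleton (hd : IsMetric d) {Δ ℓ vS F : ℝ} {x : M}
    {E : (List (Finset M) → ℝ) → ℝ} (hS : S.Nonempty)
    (hΔ : ∀ a ∈ S ∪ {x}, ∀ b ∈ S ∪ {x}, d a b ≤ Δ) (hΔℓ : Δ ≤ 4 * ℓ)
    (hℓ : ∀ a ∈ S, ℓ ≤ d a x) (hplay : Play d E S ℓ vS F) (hF : 1 / 8 ≤ F) :
    ∃ E v f, Play d E (S ∪ {x}) ℓ v f ∧ 1 / 8 ≤ f ∧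
      Real.exp (F / growthRate) + 1 ≤ Real.exp (f / growthRate) := by
  have hℓ0 : 0 < ℓ := hplay.v_pos.trans_le hplay.v_le
  obtain ⟨s, hs⟩ := hS
  have hxU : x ∈ S ∪ {x} := Finset.mem_union_right _ (by simp)
  have hG : ∀ b ∈ ({[∅]} : Set (List (Finset M))), ∀ r ∈ b, r ⊆ ({x} : Finset M) := by
    simp
  have key : ∀ z : List (List (Finset M) ⊕ List (Finset M)),
      (∀ y ∈ z, y ∈ properLetters S ({[∅]} : Set (List (Finset M)))) →
      dpOpt d x (z.map (unionLetter S {x})).flatten ≤ 2 * Δ * (rightLetters z).length := by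
    intro z
    induction z with
    | nil => simp [rightLetters, dpOpt]
    | cons y z ih =>
      intro hz
      have ih' := ih fun y hy => hz y (by simp [hy])
      cases y with
      | inl a =>
        exact (dpOpt_stay_append_le hd a _ (by simp)).trans ih'
      | inr b =>
        have hb : b = [∅] := hz (Sum.inr b) (by simp)
        subst hb
        have e1 := dpOpt_cons_le (d := d) (s := x) (Finset.mem_union_right ∅ hs)
          (z.map (unionLetter S {x})).flatten
        have e2 := dpOpt_le_add hd s x (σ := (z.map (unionLetter S {x})).flatten) fun r hr =>
          (map_unionLetter_mem ⟨s, hs⟩ hG (fun y hy => hz y (by simp [hy])) r hr).1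
        have e3 := hΔ s (Finset.mem_union_left _ hs) x hxU
        have e4 := hΔ x hxU s (Finset.mem_union_left _ hs)
        have e5 : (rightLetters (Sum.inr [∅] :: z)).length = (rightLetters z).length + 1 := rfl
        rw [e5]
        push_cast
        have e6 : (List.map (unionLetter S {x}) (Sum.inr [∅] :: z)).flatten =
          (∅ ∪ S) :: (z.map (unionLetter S {x})).flatten := rfl
        rw [e6]
        linarith
  have hℓΔ : ℓ ≤ Δ := (hℓ s hs).trans (hΔ s (Finset.mem_union_left _ hs) x hxU)
  obtain ⟨E'', v, f, h1, h2, h3⟩ := Play.merge_exp (fT := 1 / 8) (vT := ℓ) hd ⟨s, hs⟩ hΔ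
    (fun a ha b hb => by rw [Finset.mem_singleton.1 hb]; exact hℓ a ha) hplay hG
    (E' := fun φ => φ [∅]) (IsExpectation.dirac rfl) (by
      intro s' hs' A hA esc pre
      rw [Finset.mem_singleton.1 hs']
      simp only [List.map_cons, List.map_nil, mssEscCostAux]
      split_ifs
      · exact le_rfl
      · have := hA pre (∅ ∪ S) ⟨s, by simpa using hs⟩
        have h1 := hℓ _ (by simpa using this)
        rw [hd.2.1] at h1
        simpa using h1)
    (cT := fun t => 2 * Δ * t.length)
    (fun z hz => (freeOpt_le hxU _).trans (key z hz)) (by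
      intro m
      have := (isExpectation_iterExp (IsExpectation.dirac (G := {[∅]}) rfl :
        IsExpectation _ (fun φ : List (Finset M) → ℝ => φ [∅])) m).congr
        (φ := fun t => 2 * Δ * t.length) (ψ := fun _ => 2 * Δ * m) (by rintro t ⟨ht, -⟩; rw [ht])
      rw [this, (isExpectation_iterExp (IsExpectation.dirac (G := {[∅]}) rfl :
        IsExpectation _ (fun φ : List (Finset M) → ℝ => φ [∅])) m).const]
      have : (0 : ℝ) ≤ m := Nat.cast_nonneg m
      nlinarith)
    hℓ0 (by linarith) hℓΔ hF (by norm_num) hF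
  refine ⟨E'', v, f, h1, h2, le_trans ?_ h3⟩
  have := Real.one_le_exp (x := 1 / 8 / growthRate) (by have := growthRate_pos; positivity)
  linarith

lemma two_le_exp_growthRate : (2 : ℝ) ≤ Real.exp (1 / 8 / growthRate) := by
  have h1 := Real.add_one_le_exp (1 / 8 / growthRate)
  have h2 : (1 : ℝ) ≤ 1 / 8 / growthRate := by
    rw [le_div_iff₀ growthRate_pos]
    have := growthRate_le
    linarith
  linarith

lemma exists_play_pair (hd : IsMetric d) {ℓ : ℝ} {x y : M} (hℓ0 : 0 < ℓ) (h1 : ℓ ≤ d x y)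
    (h2 : d x y ≤ 4 * ℓ) :
    Play d (fun φ => (1 - 1 / 2) * φ [{x}] + 1 / 2 * φ [{y}]) ({x} ∪ {y}) ℓ (ℓ / 2) (1 / 8) := by
  have hxx := (hd.1 x x).2 rfl
  have hyy := (hd.1 y y).2 rfl
  have hyx := hd.2.1 y x
  have hE : IsExpectation {σ : List (Finset M) | σ.length = 1 ∧ σ ∈ requestSeqs ({x} ∪ {y})}
      (fun φ => (1 - 1 / 2) * φ [{x}] + 1 / 2 * φ [{y}]) :=
    (IsExpectation.dirac (by simp [requestSeqs])).mix
      (IsExpectation.dirac (by simp [requestSeqs])) (by norm_num) (by norm_num)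
  refine ⟨hE.mono_set fun σ h => h.2, by linarith, by linarith, by norm_num, ?_, fun n => ?_⟩
  · intro s hs A hA esc pre
    have hAx : A (pre ++ [{x}]) = x := by simpa using hA pre {x} (by simp)
    have hAy : A (pre ++ [{y}]) = y := by simpa using hA pre {y} (by simp)
    simp only [mssEscCostAux, hAx, hAy, add_zero]
    have hsx : 0 ≤ d s x := hd.nonneg _ _
    have hsy : 0 ≤ d s y := hd.nonneg _ _
    have htri := hd.2.2 x s y
    rw [hd.2.1 x s] at htri
    split_ifs <;> linarith
  · have hn := isExpectation_iterExp hE n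
    have e : (n : ℝ) * (ℓ / 2 / (1 / 8)) = n * (4 * ℓ) := by ring
    rw [e, ← hn.const (n * (4 * ℓ))]
    refine hn.mono fun w hw => ?_
    have hxm : x ∈ ({x} ∪ {y} : Finset M) := by simp
    refine (freeOpt_le hxm _).trans ?_
    have := dpOpt_le_mul_length (d := d) (U := {x} ∪ {y}) (Δ := 4 * ℓ) (by
      intro a ha b hb
      simp only [Finset.mem_union, Finset.mem_singleton] at ha hb
      rcases ha with rfl | rfl <;> rcases hb with rfl | rfl <;> linarith) hxm
      (flatten_mem_requestSeqs fun σ hσ => (hw.2 σ hσ).2)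
    have hlen : w.flatten.length = n := by
      rw [List.length_flatten, List.map_congr_left (g := fun _ => 1) fun σ hσ => (hw.2 σ hσ).1]
      simp [hw.1]
    rwa [hlen] at this

/-- `U` is a point of weight at most `1`, or it carries a play at price `p` with offline advantage
at least logarithmic in the weight `w`. -/
def Good (d : M → M → ℝ) (U : Finset M) (p w : ℝ) : Prop :=
  (∃ x, U = {x} ∧ w ≤ 1) ∨
    ∃ E v f, Play d E U p v f ∧ 1 / 8 ≤ f ∧ w ≤ Real.exp (f / growthRate)

lemma Good.mono_price {p q w : ℝ} (h : Good d S p w) (hpq : p ≤ q) : Good d S q w := by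
  rcases h with h | ⟨E, v, f, h1, h2, h3⟩
  · exact Or.inl h
  · exact Or.inr ⟨E, v, f, h1.mono hpq h1.f_pos le_rfl, h2, h3⟩

/-- Repeating a play until its value is at least half of the available price. -/
lemma Play.exists_large_value {E : (List (Finset M) → ℝ) → ℝ} {p v f q : ℝ} (h : Play d E S p v f)
    (hpq : p ≤ q) : ∃ E' v', Play d E' S q v' f ∧ q - p ≤ v' := by
  have hv := h.v_pos
  set k := ⌊(q - p) / v⌋₊
  have h1 : k * v ≤ q - p := by
    have := Nat.floor_le (a := (q - p) / v) (div_nonneg (by linarith) hv.le)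
    rwa [le_div_iff₀ hv] at this
  have h2 : q - p ≤ (k + 1) * v := by
    have := (Nat.lt_floor_add_one ((q - p) / v)).le
    rwa [div_le_iff₀ hv] at this
  exact ⟨_, _, (h.repeat k).mono (by linarith) h.f_pos le_rfl, h2⟩

lemma Good.merge (hd : IsMetric d) {ℓ wS wT : ℝ} (hℓ0 : 0 < ℓ) (hS : S.Nonempty) (hT : T.Nonempty)
    (hΔ : ∀ x ∈ S ∪ T, ∀ y ∈ S ∪ T, d x y ≤ 4 * ℓ)
    (hℓ : ∀ x ∈ S, ∀ y ∈ T, ℓ ≤ d x y) (hgS : Good d S ℓ wS) (hgT : Good d T (ℓ / 2) wT)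
    (hw : wT ≤ wS) : Good d (S ∪ T) ℓ (wS + wT) := by
  rcases hgS with ⟨x, rfl, hx⟩ | ⟨E, v, f, h1, h2, h3⟩ <;>
    rcases hgT with ⟨y, rfl, hy⟩ | ⟨E', v', f', h1', h2', h3'⟩
  · refine Or.inr ⟨_, _, _, exists_play_pair hd hℓ0 (hℓ x (by simp) y (by simp))
      (hΔ x (by simp) y (by simp)), le_rfl, ?_⟩
    have := two_le_exp_growthRate
    linarith
  · rw [Finset.union_comm] at hΔ ⊢
    obtain ⟨E'', v'', f'', e1, e2, e3⟩ := Play.merge_singleton hd hT hΔ le_rfl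
      (fun a ha => by rw [hd.2.1]; exact hℓ x (by simp) a ha)
      (h1'.mono (by linarith) h1'.f_pos le_rfl) h2'
    exact Or.inr ⟨E'', v'', f'', e1, e2, by linarith⟩
  · obtain ⟨E'', v'', f'', e1, e2, e3⟩ := Play.merge_singleton hd hS hΔ le_rfl
      (fun a ha => hℓ a ha y (by simp)) h1 h2
    exact Or.inr ⟨E'', v'', f'', e1, e2, by linarith⟩
  · obtain ⟨E₂, v₂, e4, e5⟩ := h1'.exists_large_value (q := ℓ) (by linarith)
    obtain ⟨E'', v'', f'', e1, e2, e3⟩ := Play.merge_play hd hS hT hΔ hℓ h1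
      (e4.mono le_rfl (lt_min h1'.f_pos h1.f_pos) (min_le_left f' f)) (by linarith) h2
      (min_le_right f' f)
    refine Or.inr ⟨E'', v'', f'', e1, e2, le_trans ?_ e3⟩
    rcases min_choice f' f with h | h <;> rw [h] <;> linarith

/-- Merging a family of clusters, in the order of decreasing weights. -/
lemma Good.biUnion (hd : IsMetric d) {ι : Type*} {ℓ : ℝ} (hℓ0 : 0 < ℓ) (P : Finset ι)
    (U : ι → Finset M) (w : ι → ℝ) (hP : P.Nonempty) (hU : ∀ i ∈ P, (U i).Nonempty)
    (hw : ∀ i ∈ P, 0 < w i) (hg : ∀ i ∈ P, Good d (U i) (ℓ / 2) (w i))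
    (hΔ : ∀ i ∈ P, ∀ j ∈ P, ∀ x ∈ U i, ∀ y ∈ U j, d x y ≤ 4 * ℓ)
    (hℓ : ∀ i ∈ P, ∀ j ∈ P, i ≠ j → ∀ x ∈ U i, ∀ y ∈ U j, ℓ ≤ d x y) :
    Good d (P.biUnion U) ℓ (∑ i ∈ P, w i) := by
  induction P using Finset.induction_on_min_value w with
  | empty => simp at hP
  | insert a P ha hmin ih =>
    rcases P.eq_empty_or_nonempty with rfl | hPne
    · simpa using (hg a (by simp)).mono_price (by linarith)
    · have hsub : ∀ i ∈ P, i ∈ insert a P := fun i hi => Finset.mem_insert_of_mem hi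
      have haP : a ∈ insert a P := Finset.mem_insert_self _ _
      have ih' := ih hPne (fun i hi => hU i (hsub i hi)) (fun i hi => hw i (hsub i hi))
        (fun i hi => hg i (hsub i hi))
        (fun i hi j hj => hΔ i (hsub i hi) j (hsub j hj))
        (fun i hi j hj => hℓ i (hsub i hi) j (hsub j hj))
      rw [Finset.biUnion_insert, Finset.sum_insert ha, Finset.union_comm, add_comm]
      refine Good.merge hd hℓ0 ?_ (hU a haP) ?_ ?_ ih' (hg a haP) ?_
      · obtain ⟨i, hi⟩ := hPne
        exact (hU i (hsub i hi)).mono (Finset.subset_biUnion_of_mem U hi)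
      · have hmem : ∀ x ∈ P.biUnion U ∪ U a, ∃ i ∈ insert a P, x ∈ U i := by
          intro x hx
          rcases Finset.mem_union.1 hx with hx | hx
          · obtain ⟨i, hi, hx⟩ := Finset.mem_biUnion.1 hx
            exact ⟨i, hsub i hi, hx⟩
          · exact ⟨a, haP, hx⟩
        intro x hx y hy
        obtain ⟨i, hi, hx⟩ := hmem x hx
        obtain ⟨j, hj, hy⟩ := hmem y hy
        exact hΔ i hi j hj x hx y hy
      · intro x hx y hy
        obtain ⟨i, hi, hx⟩ := Finset.mem_biUnion.1 hx
        exact hℓ i (hsub i hi) a haP (by rintro rfl; exact ha hi) x hx y hy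
      · obtain ⟨i, hi⟩ := hPne
        exact (hmin i hi).trans
          (Finset.single_le_sum (fun j hj => (hw j (hsub j hj)).le) hi)

end good

section ramsey

variable {M : Type*} {d : M → M → ℝ}

/-- A Ramsey-type statement for ultrametrics: at one of two consecutive scales, a large part of the
logarithmic cardinality survives in a well-separated subset. -/
lemma exists_good_subsets (hd : IsMetric d) (hu : ∀ x y z, d x z ≤ max (d x y) (d y z)) {ρ : ℝ}
    (hρ : 0 < ρ) (hmin : ∀ x y, x ≠ y → ρ < d x y) (n : ℕ) (S : Finset M) (hS : S.Nonempty)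
    (hdiam : ∀ x ∈ S, ∀ y ∈ S, d x y ≤ ρ * 4 ^ n) :
    ∃ A ⊆ S, ∃ B ⊆ S, ∃ a b : ℝ, A.Nonempty ∧ B.Nonempty ∧ 0 < a ∧ 0 < b ∧
      Good d A (ρ * 4 ^ n / 4) a ∧ Good d B (ρ * 4 ^ n / 16) b ∧ (S.card : ℝ) ≤ a * b := by
  induction n generalizing S with
  | zero =>
    obtain ⟨x, hx⟩ := hS
    have hSx : S = {x} := by
      refine Finset.eq_singleton_iff_unique_mem.2 ⟨hx, fun y hy => ?_⟩
      by_contra h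
      have h1 := hmin y x h
      have h2 := hdiam y hy x hx
      rw [pow_zero, mul_one] at h2
      linarith
    exact ⟨{x}, by simp [hSx], {x}, by simp [hSx], 1, 1, by simp, by simp, one_pos, one_pos,
      Or.inl ⟨x, rfl, le_rfl⟩, Or.inl ⟨x, rfl, le_rfl⟩, by simp [hSx]⟩
  | succ n ih =>
    set ℓ := ρ * 4 ^ n with hℓ
    have hℓ0 : 0 < ℓ := by positivity
    have hℓ4 : ρ * 4 ^ (n + 1) = 4 * ℓ := by rw [hℓ]; ring
    rw [hℓ4] at hdiam ⊢
    set C : M → Finset M := fun x => S.filter (d x · ≤ ℓ) with hC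
    have hCsymm : ∀ x y, d x y ≤ ℓ → d y x ≤ ℓ := fun x y h => by rwa [hd.2.1]
    have htrans : ∀ x y z, d x y ≤ ℓ → d y z ≤ ℓ → d x z ≤ ℓ := fun x y z h h' =>
      (hu x y z).trans (max_le h h')
    have hCeq : ∀ x y, d x y ≤ ℓ → C x = C y := by
      intro x y h
      ext z
      simp only [hC, Finset.mem_filter]
      exact and_congr_right fun _ => ⟨htrans y x z (hCsymm x y h), htrans x y z h⟩
    have hself : ∀ x ∈ S, x ∈ C x := fun x hx => by
      simpa [hC, hx, (hd.1 x x).2 rfl] using hℓ0.le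
    set P := S.image C with hP
    have hP0 : P.Nonempty := hS.image C
    have hsub : ∀ K ∈ P, K ⊆ S := by
      intro K hK
      obtain ⟨x, -, rfl⟩ := Finset.mem_image.1 hK
      exact Finset.filter_subset _ _
    have hKeq : ∀ K ∈ P, ∀ x ∈ K, K = C x := by
      intro K hK x hx
      obtain ⟨y, -, rfl⟩ := Finset.mem_image.1 hK
      exact hCeq y x (Finset.mem_filter.1 hx).2
    have hex : ∀ K : Finset M, ∃ (A B : Finset M) (a b : ℝ), K ∈ P → A ⊆ K ∧ B ⊆ K ∧
        A.Nonempty ∧ B.Nonempty ∧ 0 < a ∧ 0 < b ∧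
        Good d A (ℓ / 4) a ∧ Good d B (ℓ / 16) b ∧ (K.card : ℝ) ≤ a * b := by
      intro K
      by_cases hK : K ∈ P
      · have hne : K.Nonempty := by
          obtain ⟨x, hx, rfl⟩ := Finset.mem_image.1 hK
          exact ⟨x, hself x hx⟩
        obtain ⟨A, hA, B, hB, a, b, h⟩ := ih K hne fun x hx y hy => by
          rw [hKeq K hK x hx] at hy
          exact (Finset.mem_filter.1 hy).2
        exact ⟨A, B, a, b, fun _ => ⟨hA, hB, h⟩⟩
      · exact ⟨∅, ∅, 0, 0, fun h => absurd h hK⟩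
    choose A B a b hAB using hex
    obtain ⟨K, hK, hmax⟩ := Finset.exists_max_image P a hP0
    refine ⟨P.biUnion B, Finset.biUnion_subset.2 fun L hL => (hAB L hL).2.1.trans (hsub L hL), A K,
      (hAB K hK).1.trans (hsub K hK), ∑ L ∈ P, b L, a K, ?_, (hAB K hK).2.2.1,
      Finset.sum_pos (fun L hL => (hAB L hL).2.2.2.2.2.1) hP0, (hAB K hK).2.2.2.2.1, ?_, ?_, ?_⟩
    · exact (hAB K hK).2.2.2.1.mono (Finset.subset_biUnion_of_mem B hK)
    · have e : 4 * ℓ / 4 = ℓ := by ring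
      rw [e]
      refine Good.biUnion hd hℓ0 P B b hP0 (fun L hL => (hAB L hL).2.2.2.1)
        (fun L hL => (hAB L hL).2.2.2.2.2.1)
        (fun L hL => (hAB L hL).2.2.2.2.2.2.2.1.mono_price (by linarith)) ?_ ?_
      · intro L hL L' hL' x hx y hy
        exact hdiam x (hsub L hL ((hAB L hL).2.1 hx)) y (hsub L' hL' ((hAB L' hL').2.1 hy))
      · intro L hL L' hL' hne x hx y hy
        by_contra! h
        refine hne ?_
        rw [hKeq L hL x ((hAB L hL).2.1 hx), hKeq L' hL' y ((hAB L' hL').2.1 hy)]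
        exact hCeq x y h.le
    · have e : 4 * ℓ / 16 = ℓ / 4 := by ring
      rw [e]
      exact (hAB K hK).2.2.2.2.2.2.1
    · have h1 : S.card ≤ ∑ L ∈ P, L.card := by
        refine le_trans (Finset.card_le_card fun x hx => ?_) Finset.card_biUnion_le
        exact Finset.mem_biUnion.2 ⟨C x, Finset.mem_image_of_mem C hx, hself x hx⟩
      calc (S.card : ℝ) ≤ ∑ L ∈ P, (L.card : ℝ) := by exact_mod_cast h1
        _ ≤ ∑ L ∈ P, b L * a K := Finset.sum_le_sum fun L hL => by
            obtain ⟨-, -, -, -, ha, hb, -, -, h⟩ := hAB L hL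
            rw [mul_comm]
            exact h.trans (mul_le_mul_of_nonneg_right (hmax L hL) hb.le)
        _ = (∑ L ∈ P, b L) * a K := by rw [Finset.sum_mul]

end ramsey

section universal

lemma IsExpectation.exists_fin {β : Type*} {G : Set β} {E : (β → ℝ) → ℝ} (hE : IsExpectation G E) :
    ∃ (N : ℕ) (P : Fin N → ℝ) (ρ : Fin N → β), (∀ i, 0 ≤ P i) ∧ ∑ i, P i = 1 ∧ (∀ i, ρ i ∈ G) ∧
      (∀ φ, E φ = ∑ i, P i * φ (ρ i)) ∧
      ∀ (h : ℕ) (φ : List β → ℝ), iterExp E h φ =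
        ∑ f : Fin h → Fin N, (∏ i, P (f i)) * φ (List.ofFn fun i => ρ (f i)) := by
  obtain ⟨ι, _, P, ρ, h0, h1, hG, hE⟩ := hE
  set e := Fintype.equivFin ι
  have hE' : ∀ φ, E φ = ∑ i, P (e.symm i) * φ (ρ (e.symm i)) := fun φ => by
    rw [hE, e.symm.sum_comp fun i => P i * φ (ρ i)]
  refine ⟨Fintype.card ι, fun i => P (e.symm i), fun i => ρ (e.symm i), fun i => h0 _, ?_,
    fun i => hG _, hE', fun h => ?_⟩
  · rw [e.symm.sum_comp P, h1]
  · induction h with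
    | zero => simp [iterExp]
    | succ h ih =>
      intro φ
      rw [iterExp, hE', ← (Fin.consEquiv fun _ => Fin (Fintype.card ι)).sum_comp,
        Fintype.sum_prod_type]
      refine Finset.sum_congr rfl fun i _ => ?_
      rw [ih, Finset.mul_sum]
      refine Finset.sum_congr rfl fun f _ => ?_
      simp [Fin.prod_univ_succ, List.ofFn_succ, Fin.consEquiv, mul_assoc]

variable {M : Type*} {d : M → M → ℝ} {U : Finset M} {Δ : ℝ}

/-- A play of value `Δ` at price `2 * Δ` provides the required distribution. -/
lemma Play.exists_distribution (hd : IsMetric d) {E : (List (Finset M) → ℝ) → ℝ} {f c : ℝ}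
    (hΔ : ∀ x ∈ U, ∀ y ∈ U, d x y ≤ Δ) (hplay : Play d E U (2 * Δ) Δ f) (hc0 : 0 ≤ c)
    (hc : c ≤ f / 2) (hopt : ∀ s ∈ U, E (fun σ => dpOpt d s σ) ≤ Δ) :
    ∃ (N : ℕ) (P : Fin N → ℝ) (ρ : Fin N → List (Finset M)),
      (∀ ω, 0 ≤ P ω) ∧ (∑ ω, P ω) = 1 ∧
      (∀ ω : Fin N, ∀ r ∈ ρ ω, Finset.Nonempty r ∧ (↑r : Set M) ⊆ ↑U) ∧
      ∀ s ∈ U,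
        (∀ A : List (Finset M) → M, MssAlg A → ∀ esc : List (Finset M) → Bool,
          Δ ≤ ∑ ω, P ω * mssEscCost d (2 * Δ) A esc s (ρ ω)) ∧
        ((∑ ω, P ω * mssOpt d s (ρ ω)) ≤ Δ) ∧
        (∃ h₀ : ℕ, ∀ h : ℕ, h₀ ≤ h →
          c * (∑ f : Fin h → Fin N, (∏ i, P (f i)) *
            mssOpt d s (List.ofFn (fun i => ρ (f i))).flatten) ≤ (h : ℝ) * Δ) := by
  obtain ⟨N, P, ρ, h0, h1, hG, hE, hiter⟩ := hplay.isExpectation.exists_fin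
  refine ⟨N, P, ρ, h0, h1, fun ω r hr => ⟨(hG ω r hr).1, Finset.coe_subset.2 (hG ω r hr).2⟩,
    fun s hs => ⟨fun A hA esc => ?_, ?_, ⌈f⌉₊, fun h hh => ?_⟩⟩
  · exact (hplay.game s hs A hA esc []).trans_eq (hE _)
  · refine le_trans ?_ (hopt s hs)
    rw [← hE]
    exact hplay.isExpectation.mono fun σ hσ => mssOpt_le_dpOpt hd fun r hr => (hσ r hr).1
  · have hexp := isExpectation_iterExp hplay.isExpectation h
    rw [← hiter h fun w => mssOpt d s w.flatten]
    have hbound : iterExp E h (fun w => mssOpt d s w.flatten) ≤ Δ + h * (Δ / f) := by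
      refine le_trans ?_ (add_le_add_right (hplay.offline h) Δ)
      rw [← hexp.const_add]
      refine hexp.mono fun w hw => ?_
      have hw' := flatten_mem_requestSeqs hw.2
      exact (mssOpt_le_dpOpt hd fun r hr => (hw' r hr).1).trans
        (dpOpt_le_diam_add_freeOpt hd ⟨s, hs⟩ hΔ hs hw')
    have hf := hplay.f_pos
    have hΔ0 := hplay.v_pos
    have hfh : f ≤ h := (Nat.le_ceil f).trans (by exact_mod_cast hh)
    calc c * _ ≤ c * (Δ + h * (Δ / f)) := mul_le_mul_of_nonneg_left hbound hc0
      _ ≤ f / 2 * (Δ + h * (Δ / f)) := mul_le_mul_of_nonneg_right hc (by positivity)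
      _ = f * Δ / 2 + h * Δ / 2 := by field_simp
      _ ≤ h * Δ := by nlinarith

/-- The distribution for spaces of bounded cardinality: two rounds on a diametral pair. -/
lemma exists_play_diametral_pair (hd : IsMetric d) {x y : M} (hxy : 0 < d x y) :
    ∃ E, Play d E ({x} ∪ {y}) (2 * d x y) (d x y) (1 / 8) ∧
      ∀ s ∈ ({x} ∪ {y} : Finset M), E (fun σ => dpOpt d s σ) ≤ d x y := by
  have h := ((exists_play_pair hd hxy le_rfl (by linarith)).repeat 1).mono
    (q := 2 * d x y) (by push_cast; linarith) (by norm_num) le_rfl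
  have e : ((1 : ℕ) + 1 : ℝ) * (d x y / 2) = d x y := by push_cast; ring
  rw [e] at h
  refine ⟨_, h, fun s hs => ?_⟩
  have key : ∀ a b, dpOpt d s [{a}, {b}] ≤ d s a + d a b := fun a b => by
    have h1 := dpOpt_cons_le (d := d) (s := s) (Finset.mem_singleton_self a) [{b}]
    have h2 := dpOpt_cons_le (d := d) (s := a) (Finset.mem_singleton_self b) []
    simp only [dpOpt, add_zero] at h1 h2 ⊢
    linarith
  have hxx := (hd.1 x x).2 rfl
  have hyy := (hd.1 y y).2 rfl
  have hyx := hd.2.1 y x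
  have hsum : d s x + d s y = d x y := by
    rcases Finset.mem_union.1 hs with hs | hs <;> rw [Finset.mem_singleton.1 hs] <;> linarith
  have h1 := key x x
  have h2 := key x y
  have h3 := key y x
  have h4 := key y y
  simp only [iterExp, List.flatten_cons, List.flatten_nil, List.append_nil, List.singleton_append]
  linarith

/-- A play with small price and large offline advantage on a subset of full diameter. -/
lemma exists_play_of_ultrametric [Fintype M] (hd : IsMetric d)
    (hu : ∀ x y z, d x z ≤ max (d x y) (d y z)) {x y : M} (hxy : 0 < d x y)
    (hmax : ∀ a b, d a b ≤ d x y) (hcard : 1 < Fintype.card M) :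
    ∃ U E v f, Play d E U (d x y / 4) v f ∧ growthRate * Real.log (Fintype.card M) / 2 ≤ f ∧
      ∃ a ∈ U, ∃ b ∈ U, d a b = d x y := by
  obtain ⟨δ, hδ, hδmin⟩ : ∃ δ, 0 < δ ∧ ∀ a b, a ≠ b → δ ≤ d a b := by
    obtain ⟨q, hq, hqmin⟩ := Finset.exists_min_image
      (Finset.univ.filter fun q : M × M => q.1 ≠ q.2) (fun q => d q.1 q.2)
      ⟨(x, y), by simpa using fun h : x = y => hxy.ne' ((hd.1 x y).2 h)⟩
    have hq' : q.1 ≠ q.2 := by simpa using hq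
    exact ⟨d q.1 q.2, lt_of_le_of_ne (hd.nonneg _ _) fun h => hq' ((hd.1 _ _).1 h.symm),
      fun a b hab => hqmin (a, b) (by simpa using hab)⟩
  set Δ := d x y with hΔ
  obtain ⟨n, hn⟩ := pow_unbounded_of_one_lt (Δ / δ) (by norm_num : (1 : ℝ) < 4)
  have hn4 : (0 : ℝ) < 4 ^ n := by positivity
  have hΔn : Δ / 4 ^ n < δ := by
    rw [div_lt_iff₀ hδ] at hn
    rw [div_lt_iff₀ hn4]
    linarith
  have hmul : Δ / 4 ^ n * 4 ^ n = Δ := div_mul_cancel₀ _ hn4.ne'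
  obtain ⟨A, -, B, -, a, b, hA0, hB0, ha, hb, hA, hB, hab⟩ :=
    exists_good_subsets hd hu (div_pos hxy hn4) (fun a b h => hΔn.trans_le (hδmin a b h)) n
      Finset.univ ⟨x, Finset.mem_univ x⟩ (fun a _ b _ => by rw [hmul]; exact hmax a b)
  rw [hmul] at hA hB
  rw [Finset.card_univ] at hab
  have hcard' : (1 : ℝ) < Fintype.card M := by exact_mod_cast hcard
  obtain ⟨W, w, hW0, hW, hw0, hw⟩ : ∃ (W : Finset M) (w : ℝ), W.Nonempty ∧ Good d W (Δ / 4) w ∧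
      0 < w ∧ (Fintype.card M : ℝ) ≤ w * w := by
    rcases le_total b a with h | h
    · exact ⟨A, a, hA0, hA, ha, hab.trans (mul_le_mul_of_nonneg_left h ha.le)⟩
    · exact ⟨B, b, hB0, hB.mono_price (by linarith), hb,
        hab.trans (mul_le_mul_of_nonneg_right h hb.le)⟩
  have hlog : Real.log (Fintype.card M) ≤ 2 * Real.log w := by
    have := Real.log_le_log (by linarith) hw
    rw [Real.log_mul hw0.ne' hw0.ne'] at this
    linarith
  have hα := growthRate_pos
  have hbound : ∀ f, w ≤ Real.exp (f / growthRate) →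
      growthRate * Real.log (Fintype.card M) / 2 ≤ f := by
    intro f hf
    have h1 := (Real.log_le_iff_le_exp hw0).2 hf
    rw [le_div_iff₀ hα] at h1
    nlinarith
  rcases hW with ⟨z, -, hz⟩ | ⟨E, v, f, hplay, hf8, hf⟩
  · nlinarith
  by_cases hdiam : ∃ a ∈ W, ∃ b ∈ W, d a b = Δ
  · exact ⟨W, E, v, f, hplay, hbound f hf, hdiam⟩
  push Not at hdiam
  have hlt : ∀ a ∈ W, ∀ b ∈ W, d a b < Δ := fun a ha b hb =>
    lt_of_le_of_ne (hmax a b) (hdiam a ha b hb)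
  obtain ⟨c, hc⟩ := hW0
  obtain ⟨z, hz⟩ : ∃ z, d c z = Δ := by
    rcases le_max_iff.1 (hu x c y) with h | h
    · exact ⟨x, le_antisymm (hmax c x) (by rw [hd.2.1 c x]; exact h)⟩
    · exact ⟨y, le_antisymm (hmax c y) h⟩
  have hWz : ∀ a ∈ W, Δ ≤ d a z := by
    intro a ha
    rcases le_max_iff.1 (hu c a z) with h | h
    · have := hlt c hc a ha
      linarith
    · linarith
  obtain ⟨E', v', f', h1, -, h3⟩ := Play.merge_singleton hd ⟨c, hc⟩ (x := z) (Δ := Δ)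
    (fun a _ b _ => hmax a b) (by linarith) (fun a ha => by have := hWz a ha; linarith) hplay hf8
  exact ⟨W ∪ {z}, E', v', f', h1, hbound f' (by linarith), c, by simp [hc], z, by simp, hz⟩

/-- Rescaling a play with small price to value `Δ` while keeping the offline cost below `Δ`. -/
lemma Play.exists_normalized (hd : IsMetric d) {E : (List (Finset M) → ℝ) → ℝ} {v f : ℝ}
    (hΔ : ∀ x ∈ U, ∀ y ∈ U, d x y ≤ Δ) (hplay : Play d E U (Δ / 4) v f) (hf : 3 ≤ f) :
    ∃ E', Play d E' U (2 * Δ) Δ f ∧ ∀ s ∈ U, E' (fun σ => dpOpt d s σ) ≤ Δ := by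
  have hΔ0 : 0 < Δ := by
    have := hplay.v_pos
    have := hplay.v_le
    linarith
  obtain ⟨E₁, V, hE₁, hV⟩ := hplay.exists_large_value (q := 2 * Δ) (by linarith)
  have hV0 := hE₁.v_pos
  have hθ1 : Δ / V ≤ 2 / 3 := by
    rw [div_le_iff₀ hV0]
    linarith
  have h := hE₁.null_mix (θ := Δ / V) (by positivity) (by linarith)
  rw [div_mul_cancel₀ _ hV0.ne'] at h
  refine ⟨_, h, fun s hs => ?_⟩
  have h1 : E₁ (fun σ => freeOpt d U σ) ≤ V / f := by
    have := hE₁.offline 1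
    simpa [iterExp] using this
  have h2 : E₁ (fun σ => dpOpt d s σ) ≤ Δ + V / f := by
    refine le_trans ?_ (add_le_add_right h1 Δ)
    rw [← hE₁.isExpectation.const_add]
    exact hE₁.isExpectation.mono fun σ hσ => dpOpt_le_diam_add_freeOpt hd ⟨s, hs⟩ hΔ hs hσ
  have h3 : Δ / V * (V / f) ≤ Δ * (1 / 3) := by
    have e : Δ / V * (V / f) = Δ * (1 / f) := by field_simp
    rw [e]
    exact mul_le_mul_of_nonneg_left (one_div_le_one_div_of_le (by norm_num) hf) hΔ0.le
  have h4 := mul_le_mul_of_nonneg_left h2 (show 0 ≤ Δ / V by positivity)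
  have h5 := mul_le_mul_of_nonneg_right hθ1 hΔ0.le
  simp only [dpOpt, mul_zero, zero_add]
  linarith

end universal

/-- the key lemma for the universal lower bound. There is a
constant `α > 0` such that for every finite (nonempty) ultrametric space
`(U', d)` there exist a subspace `U ⊆ U'` whose diameter `Δ` equals the
diameter of `U'` and a finitely supported distribution `(P, ρ)` over MSS
request sequences inside `U` such that for every starting point `s ∈ U`:
(i) every deterministic online algorithm, even with an escape price `2·Δ`
available throughout, pays at least `Δ` in expectation, while the expected
optimal cost is at most `Δ`; and (ii) there is `h₀ ∈ ℕ` such that for all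
`h ≥ h₀`, concatenating `h` i.i.d. samples from the distribution gives
`h·Δ ≥ α·log|U'|·E[optimal cost of the concatenation]`. -/
theorem mss_ultrametric_universal_lemma :
    ∃ α : ℝ, 0 < α ∧
      ∀ (U' : Type u) (d : U' → U' → ℝ), Finite U' → Nonempty U' →
        IsMetric d → (∀ x y z : U', d x z ≤ max (d x y) (d y z)) →
        ∃ (U : Finset U') (Δ : ℝ),
          U.Nonempty ∧
          -- Δ is the diameter of U', attained inside U, hence diam U = diam U' = Δ
          (∀ x y : U', d x y ≤ Δ) ∧
          (∃ x ∈ U, ∃ y ∈ U, d x y = Δ) ∧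
          ∃ (N : ℕ) (P : Fin N → ℝ) (ρ : Fin N → List (Finset U')),
            (∀ ω, 0 ≤ P ω) ∧ (∑ ω, P ω) = 1 ∧
            -- requests are nonempty subsets of U
            (∀ ω : Fin N, ∀ r ∈ ρ ω, Finset.Nonempty r ∧ (↑r : Set U') ⊆ ↑U) ∧
            ∀ s ∈ U,
              -- (i) expected online cost ≥ Δ (even with escape price 2Δ),
              --     expected optimal cost ≤ Δ
              (∀ A : List (Finset U') → U', MssAlg A →
                ∀ esc : List (Finset U') → Bool,
                  Δ ≤ ∑ ω, P ω * mssEscCost d (2 * Δ) A esc s (ρ ω)) ∧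
              ((∑ ω, P ω * mssOpt d s (ρ ω)) ≤ Δ) ∧
              -- (ii) the h-fold i.i.d. concatenation has small optimal cost
              (∃ h₀ : ℕ, ∀ h : ℕ, h₀ ≤ h →
                α * Real.log (Nat.card U') *
                    (∑ f : Fin h → Fin N, (∏ i, P (f i)) *
                      mssOpt d s (List.ofFn (fun i => ρ (f i))).flatten) ≤
                  (h : ℝ) * Δ) := by
  have hα := growthRate_pos
  refine ⟨growthRate / 96, by positivity, fun U' d hfin hne hd hu => ?_⟩
  have := Fintype.ofFinite U'
  obtain ⟨⟨x, y⟩, -, hmax⟩ := Finset.exists_max_image (Finset.univ : Finset (U' × U'))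
    (fun q => d q.1 q.2) Finset.univ_nonempty
  replace hmax : ∀ a b, d a b ≤ d x y := fun a b => hmax (a, b) (Finset.mem_univ _)
  rw [Nat.card_eq_fintype_card]
  have hcard1 : 1 ≤ Fintype.card U' := Fintype.card_pos
  rcases hcard1.eq_or_lt with hcard | hcard
  · have hsub : ∀ a b : U', a = b := fun a b =>
      Fintype.card_le_one_iff.1 hcard.ge a b
    have hd0 : ∀ a b, d a b = 0 := fun a b => (hd.1 a b).2 (hsub a b)
    refine ⟨{x}, 0, by simp, fun a b => (hd0 a b).le, ⟨x, by simp, x, by simp, hd0 x x⟩,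
      1, fun _ => 1, fun _ => [], by simp, by simp, by simp, fun s _ => ⟨fun A _ esc => ?_, ?_,
      0, fun h _ => ?_⟩⟩
    · simp [mssEscCost, mssEscCostAux]
    · simpa [dpOpt] using mssOpt_le_dpOpt (s := s) (σ := []) hd (by simp)
    · simp [← hcard]
  have hxy : 0 < d x y := by
    obtain ⟨a, b, hab⟩ := Fintype.exists_pair_of_one_lt_card hcard
    exact (lt_of_le_of_ne (hd.nonneg a b) fun h => hab ((hd.1 a b).1 h.symm)).trans_le (hmax a b)
  have hL : 0 ≤ Real.log (Fintype.card U') := Real.log_natCast_nonneg _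
  rcases le_total (growthRate * Real.log (Fintype.card U')) 6 with hsmall | hlarge
  · obtain ⟨E, hE, hopt⟩ := exists_play_diametral_pair hd hxy
    exact ⟨{x} ∪ {y}, d x y, ⟨x, by simp⟩, hmax, ⟨x, by simp, y, by simp, rfl⟩,
      hE.exists_distribution hd (fun a _ b _ => hmax a b) (by positivity) (by linarith) hopt⟩
  · obtain ⟨U, E, v, f, hplay, hf, a, ha, b, hb, hab⟩ :=
      exists_play_of_ultrametric hd hu hxy hmax hcard
    obtain ⟨E', hE', hopt⟩ := hplay.exists_normalized hd (fun a _ b _ => hmax a b) (by linarith)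
    exact ⟨U, d x y, ⟨a, ha⟩, hmax, ⟨a, ha, b, hb, hab⟩,
      hE'.exists_distribution hd (fun a _ b _ => hmax a b) (by positivity) (by linarith) hopt⟩
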